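/- arXiv:math/0311117 — 4 statements merged into one kernel-verified Lean document; each statement's English description precedes it below -/
import Mathlib

section
/- Let K be a number field whose ring of integers O_K is a principal ideal domain, and let A be an m×m matrix with entries in O_K. Then there exist B ∈ GL_m(O_K) and a partition m = m₁ + ⋯ + m_d such that B·A·B⁻¹ is block upper triangular with respect to this partition (all blocks strictly below the block diagonal are zero) and each of the d diagonal blocks has characteristic polynomial irreducible over K. -/
open scoped NumberField

open Polynomial Module

/-- If a monic polynomial `q` and a nonzero functional `φ` satisfy `φ ∘ q(f) = 0` and `q` has degree
less than the rank, then the largest `f`-invariant submodule of `ker φ` is nonzero and proper, with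
torsion-free quotient. -/
theorem LinearMap.exists_invariant_submodule_of_dual_comp_aeval_eq_zero
    {R M : Type*} [CommRing R] [IsDomain R] [AddCommGroup M] [Module R M]
    [Module.Finite R M] (f : End R M) {q : R[X]} (hq : q.Monic)
    (hdeg : q.natDegree < finrank R M) {φ : Dual R M} (hφ : φ ≠ 0) (hφq : φ ∘ₗ aeval f q = 0) :
    ∃ N : Submodule R M, N ≤ N.comap f ∧ N ≠ ⊥ ∧ N ≠ ⊤ ∧ IsTorsionFree R (M ⧸ N) := by
  have hker (x : M) : φ (aeval f q x) = 0 := LinearMap.congr_fun hφq x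
  have hkey (x : M) (hx : ∀ i < q.natDegree, φ ((f ^ i) x) = 0) :
      φ ((f ^ q.natDegree) x) = 0 := by
    have h := hker x
    rw [aeval_eq_sum_range, Finset.sum_range_succ, hq.coeff_natDegree, one_smul,
      LinearMap.add_apply, map_add, LinearMap.sum_apply, map_sum, Finset.sum_eq_zero, zero_add] at h
    · exact h
    · intro i hi
      rw [LinearMap.smul_apply, map_smul, hx i (Finset.mem_range.mp hi), smul_zero]
  let Φ : M →ₗ[R] (Fin q.natDegree → R) := LinearMap.pi fun i => φ ∘ₗ (f ^ (i : ℕ))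
  have hmem (x : M) : x ∈ LinearMap.ker Φ ↔ ∀ i < q.natDegree, φ ((f ^ i) x) = 0 := by
    rw [LinearMap.mem_ker, funext_iff, Fin.forall_iff]
    rfl
  refine ⟨LinearMap.ker Φ, fun x hx => ?_, fun hbot => ?_, fun htop => hφ ?_, ?_⟩
  · rw [Submodule.mem_comap, hmem]
    rw [hmem] at hx
    intro i hi
    rw [← Module.End.mul_apply, ← pow_succ]
    obtain h | h := (Nat.succ_le_of_lt hi).lt_or_eq
    · exact hx _ h
    · rw [← Nat.succ_eq_add_one, h]
      exact hkey x hx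
  · have := LinearMap.finrank_le_finrank_of_injective (LinearMap.ker_eq_bot.mp hbot)
    rw [finrank_fin_fun] at this
    omega
  · ext x
    have hx := (hmem x).mp (htop ▸ Submodule.mem_top)
    obtain h | h := Nat.eq_zero_or_pos q.natDegree
    · have := hkey x hx
      rwa [h] at this
    · exact hx 0 h
  · exact Φ.quotKerEquivRange.injective.moduleIsTorsionFree _ (map_smul _)

/-- An endomorphism with reducible characteristic polynomial stabilizes a nonzero proper submodule
with torsion-free quotient. -/
theorem LinearMap.exists_invariant_submodule_of_not_irreducible_charpoly
    {R M : Type*} [CommRing R] [IsDomain R] [AddCommGroup M] [Module R M]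
    [Module.Finite R M] [Module.Free R M] [Nontrivial M] (f : End R M)
    (hf : ¬ Irreducible f.charpoly) :
    ∃ N : Submodule R M, N ≤ N.comap f ∧ N ≠ ⊥ ∧ N ≠ ⊤ ∧ IsTorsionFree R (M ⧸ N) := by
  have hpos : 0 < finrank R M := finrank_pos
  have hne : f.charpoly ≠ 1 := by
    intro h
    have := f.charpoly_natDegree
    rw [h, natDegree_one] at this
    omega
  rw [f.charpoly_monic.irreducible_iff_natDegree, not_and] at hf
  have hfac := hf hne
  push Not at hfac
  obtain ⟨q, r, hq, hr, hqr, hq0, hr0⟩ := hfac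
  have hdeg : q.natDegree + r.natDegree = finrank R M := by
    rw [← f.charpoly_natDegree, ← hqr, hq.natDegree_mul hr]
  by_cases hrf : aeval f r = 0
  · obtain ⟨x, hx⟩ := exists_ne (0 : M)
    obtain ⟨φ, hφ⟩ := not_forall.mp (mt (forall_dual_apply_eq_zero_iff R x).mp hx)
    refine f.exists_invariant_submodule_of_dual_comp_aeval_eq_zero hr (by omega)
      (φ := φ) (fun h => hφ (by simp [h])) (by simp [hrf])
  · obtain ⟨x, hx⟩ := not_forall.mp (mt LinearMap.ext hrf)
    obtain ⟨φ, hφ⟩ := not_forall.mp (mt (forall_dual_apply_eq_zero_iff R _).mp hx)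
    refine f.exists_invariant_submodule_of_dual_comp_aeval_eq_zero hq (by omega)
      (φ := φ ∘ₗ aeval f r) (fun h => hφ (LinearMap.congr_fun h x)) ?_
    rw [LinearMap.comp_assoc, ← Module.End.mul_eq_comp, ← map_mul, mul_comm, hqr,
      f.aeval_self_charpoly, LinearMap.comp_zero]

/-- `f` has a block upper triangular matrix in some basis, with diagonal blocks whose characteristic
polynomials are irreducible over `K`; the blocks are the fibers of a monotone surjection `π`. -/
def LinearMap.HasIrreducibleBlockForm {R M : Type*} (K : Type*) [CommRing R] [Field K]
    [Algebra R K] [AddCommGroup M] [Module R M] (f : End R M) : Prop :=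
  ∃ (ι κ : Type) (_ : LinearOrder ι) (_ : Fintype ι) (_ : LinearOrder κ) (_ : Fintype κ)
    (b : Basis ι R M) (π : ι → κ), Monotone π ∧ Function.Surjective π ∧
      (∀ i j, π j < π i → LinearMap.toMatrix b b f i j = 0) ∧
      ∀ t, Irreducible ((((LinearMap.toMatrix b b f).submatrix
        (fun i : {i // π i = t} => (i : ι)) (fun i : {i // π i = t} => (i : ι))).charpoly).map
          (algebraMap R K))

/-- The characteristic polynomial of a diagonal block is invariant under reindexing. -/
theorem Matrix.charpoly_submatrix_val_eq {R m n : Type*} [CommRing R] {p : m → Prop} {q : n → Prop}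
    [Fintype {i // p i}] [Fintype {i // q i}] [DecidableEq {i // p i}] [DecidableEq {i // q i}]
    (e : {i // p i} ≃ {i // q i}) (A : Matrix m m R) (B : Matrix n n R)
    (h : ∀ i j : {i // p i}, A i j = B (e i) (e j)) :
    (A.submatrix (fun i : {i // p i} => (i : m)) (fun i : {i // p i} => (i : m))).charpoly =
      (B.submatrix (fun i : {i // q i} => (i : n)) (fun i : {i // q i} => (i : n))).charpoly := by
  rw [← Matrix.charpoly_reindex e]
  congr 1
  ext i j
  simp [h]

/-- Block forms on an invariant submodule and on the quotient by it combine. -/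
theorem LinearMap.HasIrreducibleBlockForm.of_restrict_of_mapQ {R M K : Type*} [CommRing R] [Field K]
    [Algebra R K] [AddCommGroup M] [Module R M] {f : End R M} {N : Submodule R M}
    (hN : N ≤ N.comap f) (h₁ : HasIrreducibleBlockForm K (f.restrict hN))
    (h₂ : HasIrreducibleBlockForm K (N.mapQ N f hN)) : HasIrreducibleBlockForm K f := by
  obtain ⟨ι₁, κ₁, _, _, _, _, b₁, π₁, hm₁, hs₁, ht₁, hi₁⟩ := h₁
  obtain ⟨ι₂, κ₂, _, _, _, _, b₂, π₂, hm₂, hs₂, ht₂, hi₂⟩ := h₂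
  let b : Basis (ι₁ ⊕ₗ ι₂) R M := (Basis.sumQuot b₁ b₂).reindex toLex
  let π : ι₁ ⊕ₗ ι₂ → κ₁ ⊕ₗ κ₂ := fun i => toLex (Sum.map π₁ π₂ (ofLex i))
  have h11 (i j : ι₁) : LinearMap.toMatrix b b f (toLex (Sum.inl i)) (toLex (Sum.inl j)) =
      LinearMap.toMatrix b₁ b₁ (f.restrict hN) i j := by
    rw [LinearMap.toMatrix_apply, LinearMap.toMatrix_apply]
    simp only [b, Basis.reindex_apply, Basis.repr_reindex_apply, Equiv.symm_apply_apply,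
      Basis.sumQuot_inl]
    exact Basis.sumQuot_repr_inl_of_mem b₁ b₂ _ (hN (b₁ j).2) i
  have h21 (i : ι₂) (j : ι₁) :
      LinearMap.toMatrix b b f (toLex (Sum.inr i)) (toLex (Sum.inl j)) = 0 := by
    rw [LinearMap.toMatrix_apply]
    simp only [b, Basis.reindex_apply, Basis.repr_reindex_apply, Equiv.symm_apply_apply,
      Basis.sumQuot_inl, Basis.sumQuot_repr_inr]
    rw [Submodule.mkQ_apply, (Submodule.Quotient.mk_eq_zero N).mpr (hN (b₁ j).2)]
    simp
  have h22 (i j : ι₂) : LinearMap.toMatrix b b f (toLex (Sum.inr i)) (toLex (Sum.inr j)) =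
      LinearMap.toMatrix b₂ b₂ (N.mapQ N f hN) i j := by
    rw [LinearMap.toMatrix_apply, LinearMap.toMatrix_apply]
    simp only [b, Basis.reindex_apply, Basis.repr_reindex_apply, Equiv.symm_apply_apply,
      Basis.sumQuot_repr_inr]
    rw [Submodule.mkQ_apply, ← Submodule.mapQ_apply N N f (h := hN), Basis.sumQuot_inr]
  refine ⟨ι₁ ⊕ₗ ι₂, κ₁ ⊕ₗ κ₂, inferInstance, inferInstance, inferInstance, inferInstance, b, π,
    ?_, ?_, ?_, ?_⟩
  · rintro (i | i) (j | j) hij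
    · exact Sum.Lex.inl_le_inl_iff.mpr (hm₁ (Sum.Lex.inl_le_inl_iff.mp hij))
    · exact Sum.Lex.inl_le_inr _ _
    · exact absurd hij Sum.Lex.not_inr_le_inl
    · exact Sum.Lex.inr_le_inr_iff.mpr (hm₂ (Sum.Lex.inr_le_inr_iff.mp hij))
  · exact toLex.surjective.comp ((hs₁.sumMap hs₂).comp ofLex.surjective)
  · rintro (i | i) (j | j) hij
    · exact (h11 i j).trans (ht₁ i j (Sum.Lex.inl_lt_inl_iff.mp hij))
    · exact absurd hij Sum.Lex.not_inr_lt_inl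
    · exact h21 i j
    · exact (h22 i j).trans (ht₂ i j (Sum.Lex.inr_lt_inr_iff.mp hij))
  · rintro (t | t)
    · let e : {i // π₁ i = t} ≃ {i // π i = toLex (Sum.inl t)} := Equiv.ofBijective
        (fun i => ⟨toLex (Sum.inl i.1), congrArg (toLex ∘ Sum.inl) i.2⟩)
        ⟨fun i j h => Subtype.ext (Sum.inl_injective (toLex.injective (congrArg Subtype.val h))), by
          rintro ⟨i | i, hi⟩
          · exact ⟨⟨i, Sum.inl_injective (toLex.injective hi)⟩, rfl⟩
          · exact absurd (toLex.injective hi) Sum.inr_ne_inl⟩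
      have := hi₁ t
      rwa [Matrix.charpoly_submatrix_val_eq e _ (LinearMap.toMatrix b b f)
        fun i j => (h11 i j).symm] at this
    · let e : {i // π₂ i = t} ≃ {i // π i = toLex (Sum.inr t)} := Equiv.ofBijective
        (fun i => ⟨toLex (Sum.inr i.1), congrArg (toLex ∘ Sum.inr) i.2⟩)
        ⟨fun i j h => Subtype.ext (Sum.inr_injective (toLex.injective (congrArg Subtype.val h))), by
          rintro ⟨i | i, hi⟩
          · exact absurd (toLex.injective hi) Sum.inl_ne_inr
          · exact ⟨⟨i, Sum.inr_injective (toLex.injective hi)⟩, rfl⟩⟩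
      have := hi₂ t
      rwa [Matrix.charpoly_submatrix_val_eq e _ (LinearMap.toMatrix b b f)
        fun i j => (h22 i j).symm] at this

/-- Every endomorphism of a finite free module over a principal ideal domain has a block upper
triangular form with irreducible diagonal blocks. -/
theorem LinearMap.hasIrreducibleBlockForm {R M : Type*} (K : Type*) [CommRing R] [IsDomain R]
    [IsPrincipalIdealRing R] [Field K] [Algebra R K] [IsFractionRing R K] [AddCommGroup M]
    [Module R M] [Module.Finite R M] [Module.Free R M] (f : End R M) :
    HasIrreducibleBlockForm K f := by
  induction hn : finrank R M using Nat.strong_induction_on generalizing M with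
  | _ n ih =>
  cases subsingleton_or_nontrivial M with
  | inl _ =>
    exact ⟨Fin 0, Fin 0, inferInstance, inferInstance, inferInstance, inferInstance,
      Basis.empty M, _root_.id, monotone_id, Function.surjective_id, fun i => i.elim0, fun t => t.elim0⟩
  | inr _ =>
  by_cases hf : Irreducible f.charpoly
  · let b := finBasis R M
    refine ⟨Fin (finrank R M), Unit, inferInstance, inferInstance, inferInstance, inferInstance,
      b, fun _ => (), monotone_const, fun _ => ⟨⟨0, finrank_pos⟩, rfl⟩,
      fun i j h => absurd h (lt_irrefl _), fun t => ?_⟩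
    rw [f.charpoly_monic.irreducible_iff_irreducible_map_fraction_map (K := K),
      ← f.charpoly_toMatrix b,
      ← Matrix.charpoly_reindex (Equiv.subtypeUnivEquiv fun _ => Subsingleton.elim () t).symm] at hf
    exact hf
  · obtain ⟨N, hN, hbot, htop, _⟩ := f.exists_invariant_submodule_of_not_irreducible_charpoly hf
    have : Nontrivial N := Submodule.nontrivial_iff_ne_bot.mpr hbot
    have : Nontrivial (M ⧸ N) := Submodule.Quotient.nontrivial_iff.mpr htop
    have hrank := N.finrank_quotient_add_finrank
    have hN_pos : 0 < finrank R N := finrank_pos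
    have hQ_pos : 0 < finrank R (M ⧸ N) := finrank_pos
    exact .of_restrict_of_mapQ hN (ih _ (by omega) _ rfl) (ih _ (by omega) _ rfl)

/-- **Block upper-triangular form over a PID ring of integers.**
Any square matrix over the ring of integers `𝓞 K` of a number field `K` (assumed to be a
principal ideal domain) can be conjugated by an element of `GL_m (𝓞 K)` into a block
upper-triangular matrix whose diagonal blocks have characteristic polynomials irreducible
over `K`.  The block structure is encoded by a monotone surjection `π : Fin m → Fin d`
(the fibers of `π` are the intervals of the partition `m = m₁ + ⋯ + m_d`). -/
theorem exists_block_triangular_form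
    (K : Type*) [Field K] [NumberField K] [IsPrincipalIdealRing (𝓞 K)]
    (m : ℕ) (A : Matrix (Fin m) (Fin m) (𝓞 K)) :
    ∃ (B : GL (Fin m) (𝓞 K)) (d : ℕ) (π : Fin m → Fin d),
      Monotone π ∧ Function.Surjective π ∧
      (∀ i j : Fin m, π j < π i →
        ((B : Matrix (Fin m) (Fin m) (𝓞 K)) * A *
            ((B⁻¹ : GL (Fin m) (𝓞 K)) : Matrix (Fin m) (Fin m) (𝓞 K))) i j = 0) ∧
      (∀ t : Fin d,
        Irreducible
          (((((B : Matrix (Fin m) (Fin m) (𝓞 K)) * A *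
                ((B⁻¹ : GL (Fin m) (𝓞 K)) : Matrix (Fin m) (Fin m) (𝓞 K))).submatrix
              (fun i : {i : Fin m // π i = t} => (i : Fin m))
              (fun i : {i : Fin m // π i = t} => (i : Fin m))).charpoly).map
            (algebraMap (𝓞 K) K))) := by
  obtain ⟨ι, κ, _, _, _, _, b, π, hmono, hsurj, htri, hirr⟩ :=
    LinearMap.hasIrreducibleBlockForm K (Matrix.toLin' A)
  have hcard : Fintype.card ι = m := by
    rw [← finrank_eq_card_basis b, finrank_fin_fun]
  let e : Fin m ≃o ι := Fintype.orderIsoFinOfCardEq ι hcard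
  let u : κ ≃o Fin (Fintype.card κ) := (Fintype.orderIsoFinOfCardEq κ rfl).symm
  let c : Basis (Fin m) (𝓞 K) (Fin m → 𝓞 K) := b.reindex e.symm.toEquiv
  let s : Basis (Fin m) (𝓞 K) (Fin m → 𝓞 K) := Pi.basisFun (𝓞 K) (Fin m)
  let B : GL (Fin m) (𝓞 K) :=
    ⟨c.toMatrix s, s.toMatrix c, c.toMatrix_mul_toMatrix_flip s, s.toMatrix_mul_toMatrix_flip c⟩
  have hB : (B : Matrix (Fin m) (Fin m) (𝓞 K)) * A *
      ((B⁻¹ : GL (Fin m) (𝓞 K)) : Matrix (Fin m) (Fin m) (𝓞 K)) =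
      LinearMap.toMatrix c c (Matrix.toLin' A) := by
    rw [← basis_toMatrix_mul_linearMap_toMatrix_mul_basis_toMatrix c s c s,
      LinearMap.toMatrix_eq_toMatrix', LinearMap.toMatrix'_toLin']
    rfl
  have hentry (i j : Fin m) : LinearMap.toMatrix c c (Matrix.toLin' A) i j =
      LinearMap.toMatrix b b (Matrix.toLin' A) (e i) (e j) := by
    rw [LinearMap.toMatrix_apply, LinearMap.toMatrix_apply, Basis.repr_reindex_apply,
      Basis.reindex_apply]
    rfl
  refine ⟨B, Fintype.card κ, fun i => u (π (e i)), u.monotone.comp (hmono.comp e.monotone),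
    u.surjective.comp (hsurj.comp e.surjective), fun i j hij => ?_, fun t => ?_⟩
  · rw [hB, hentry]
    exact htri _ _ (u.lt_iff_lt.mp hij)
  · let v : {i // u (π (e i)) = t} ≃ {i // π i = u.symm t} :=
      e.toEquiv.subtypeEquiv fun i => u.toEquiv.eq_symm_apply.symm
    have h := hirr (u.symm t)
    rwa [← Matrix.charpoly_submatrix_val_eq v _ _ fun i j => hentry i j, ← hB] at h
end

section
/- Let K be a number field with ring of integers O_K, let f ∈ O_K[t] be a monic polynomial irreducible over K of degree m, and let P be a finitely generated projective O_K-module of rank m. Then there is a bijection between the set of Aut_{O_K}(P)-conjugacy classes of O_K-endomorphisms A of P whose characteristic polynomial is f, and the set of isomorphism classes (as modules over O_K[t]/(f)) of nonzero ideals of O_K[t]/(f) that are isomorphic to P as O_K-modules. -/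
open scoped NumberField Polynomial TensorProduct

/-- A correspondence between `α` and `β` that is total on both sides and matches two reflexive
relations induces a bijection between the quotients. -/
theorem Quot.nonempty_equiv_of_correspondence {α β : Type*} {r : α → α → Prop}
    {s : β → β → Prop} (T : α → β → Prop) (hr : ∀ a, r a a) (hs : ∀ b, s b b)
    (hα : ∀ a, ∃ b, T a b) (hβ : ∀ b, ∃ a, T a b)
    (hT : ∀ {a b i j}, T a i → T b j → (r a b ↔ s i j)) :
    Nonempty (Quot r ≃ Quot s) := by
  choose φ hφ using hα
  choose ψ hψ using hβ
  refine ⟨⟨Quot.map φ fun a b h => (hT (hφ a) (hφ b)).1 h,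
    Quot.map ψ fun i j h => (hT (hψ i) (hψ j)).2 h, ?_, ?_⟩⟩
  · rintro ⟨a⟩
    exact Quot.sound ((hT (hψ (φ a)) (hφ a)).2 (hs _))
  · rintro ⟨i⟩
    exact Quot.sound ((hT (hφ (ψ i)) (hψ i)).1 (hr _))

namespace EndomorphismIdealClass

open Polynomial

section Ring

variable {R : Type*} [CommRing R] {f : R[X]} {P : Type*} [AddCommGroup P] [Module R P]

/-- A linear map intertwining multiplication by the class of `X` with an endomorphism `A`
intertwines the class of every polynomial `p` with `p(A)`. -/
theorem map_mk_smul {M : Type*} [AddCommGroup M] [Module R M] [Module (R[X] ⧸ Ideal.span {f}) M]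
    [IsScalarTower R (R[X] ⧸ Ideal.span {f}) M] (A : P →ₗ[R] P) (e : M →ₗ[R] P)
    (he : ∀ y, e (Ideal.Quotient.mk (Ideal.span {f}) X • y) = A (e y)) (p : R[X]) (y : M) :
    e (Ideal.Quotient.mk (Ideal.span {f}) p • y) = aeval A p (e y) := by
  induction p using Polynomial.induction_on' generalizing y with
  | add p q hp hq => simp [add_smul, hp, hq]
  | monomial n a =>
    induction n generalizing y with
    | zero =>
      have : Ideal.Quotient.mk (Ideal.span {f}) (monomial 0 a) • y = a • y := by
        rw [← algebraMap_smul (R[X] ⧸ Ideal.span {f}) a y]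
        rfl
      rw [this]
      simp [Algebra.algebraMap_eq_smul_one]
    | succ n ih =>
      rw [← monomial_mul_X, map_mul, mul_smul, ih, he, map_mul, aeval_X, Module.End.mul_apply]

/-- Linear equivalences to `P` intertwining multiplication by the class of `X` with `A` and `B`:
the endomorphisms are conjugate if and only if the modules are isomorphic. -/
theorem conj_iff_nonempty_linearEquiv {M N : Type*} [AddCommGroup M] [Module R M]
    [Module (R[X] ⧸ Ideal.span {f}) M] [IsScalarTower R (R[X] ⧸ Ideal.span {f}) M]
    [AddCommGroup N] [Module R N]
    [Module (R[X] ⧸ Ideal.span {f}) N] [IsScalarTower R (R[X] ⧸ Ideal.span {f}) N]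
    {A B : P →ₗ[R] P} (e : M ≃ₗ[R] P) (e' : N ≃ₗ[R] P)
    (he : ∀ y, e (Ideal.Quotient.mk (Ideal.span {f}) X • y) = A (e y))
    (he' : ∀ y, e' (Ideal.Quotient.mk (Ideal.span {f}) X • y) = B (e' y)) :
    (∃ U : P ≃ₗ[R] P, U.conj A = B) ↔ Nonempty (M ≃ₗ[R[X] ⧸ Ideal.span {f}] N) := by
  constructor
  · rintro ⟨U, rfl⟩
    have key : ∀ y, (e.trans U) (Ideal.Quotient.mk (Ideal.span {f}) X • y) =
        U.conj A ((e.trans U) y) := by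
      intro y
      simp [he, LinearEquiv.conj_apply]
    refine ⟨{ (e.trans U).trans e'.symm with map_smul' := fun s y => ?_ }⟩
    obtain ⟨p, rfl⟩ := Ideal.Quotient.mk_surjective s
    have h₁ := map_mk_smul (U.conj A) (e.trans U).toLinearMap key p y
    have h₂ := map_mk_smul (U.conj A) e'.toLinearMap he' p (e'.symm (U (e y)))
    apply e'.injective
    simp only [LinearEquiv.coe_coe, LinearEquiv.trans_apply, LinearEquiv.apply_symm_apply]
      at h₁ h₂
    simp [h₁, h₂]
  · rintro ⟨g⟩
    refine ⟨(e.symm.trans (g.restrictScalars R)).trans e', ?_⟩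
    ext y
    obtain ⟨y, rfl⟩ := e'.surjective y
    obtain ⟨y, rfl⟩ := g.surjective y
    simp [LinearEquiv.conj_apply, ← he, ← he']

theorem aeval_eq_zero_of_linearEquiv {M : Type*} [AddCommGroup M] [Module R M]
    [Module (R[X] ⧸ Ideal.span {f}) M] [IsScalarTower R (R[X] ⧸ Ideal.span {f}) M]
    {A : P →ₗ[R] P} (e : M ≃ₗ[R] P)
    (he : ∀ y, e (Ideal.Quotient.mk (Ideal.span {f}) X • y) = A (e y)) : aeval A f = 0 := by
  ext y
  obtain ⟨y, rfl⟩ := e.surjective y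
  have h := map_mk_smul A e.toLinearMap he f y
  have hf : Ideal.Quotient.mk (Ideal.span {f}) f • y = 0 := by
    rw [Ideal.Quotient.eq_zero_iff_mem.2 (Ideal.mem_span_singleton_self f)]
    exact zero_smul (R[X] ⧸ Ideal.span {f}) y
  rw [hf, map_zero] at h
  exact h.symm

theorem aeval_baseChange (K : Type*) [CommRing K] [Algebra R K] (A : P →ₗ[R] P) (p : R[X]) :
    aeval (A.baseChange K) (p.map (algebraMap R K)) = (aeval A p).baseChange K := by
  rw [aeval_map_algebraMap]
  exact aeval_algHom_apply (Module.End.baseChangeHom R K P) A p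

end Ring

section FractionField

variable {R : Type*} [CommRing R] {f : R[X]} {P : Type*} [AddCommGroup P] [Module R P]
variable (K : Type*) [Field K] [Algebra R K] [IsFractionRing R K]

/-- An endomorphism killed by a monic polynomial that is irreducible over the fraction field and
has the right degree has that polynomial as its characteristic polynomial. -/
theorem charpoly_baseChange_eq [IsDomain R] [Module.Finite R P] (hmonic : f.Monic)
    (hirr : Irreducible (f.map (algebraMap R K))) (hrank : Module.finrank R P = f.natDegree)
    (A : P →ₗ[R] P) (hA : aeval A f = 0) :
    (A.baseChange K).charpoly = f.map (algebraMap R K) := by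
  have hfin : Module.finrank K (K ⊗[R] P) = f.natDegree :=
    (IsBaseChange.finrank_eq (TensorProduct.isBaseChange R P K)).trans hrank
  have hdeg : (f.map (algebraMap R K)).natDegree = f.natDegree := hmonic.natDegree_map _
  have : Nontrivial (K ⊗[R] P) := by
    apply Module.nontrivial_of_finrank_pos (R := K)
    rw [hfin, ← hdeg]
    exact hirr.natDegree_pos
  have hmin := minpoly.eq_of_irreducible_of_monic hirr
    (x := A.baseChange K) (by rw [aeval_baseChange, hA, LinearMap.baseChange_zero])
    (hmonic.map _)
  refine (eq_of_monic_of_dvd_of_natDegree_le (hmonic.map _) (LinearMap.charpoly_monic _)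
    (hmin ▸ LinearMap.minpoly_dvd_charpoly _) ?_)
  rw [LinearMap.charpoly_natDegree, hfin, hdeg]

variable [Module.Flat R P]

theorem aeval_eq_zero_of_charpoly_baseChange [Module.Finite R P] {A : P →ₗ[R] P}
    (hA : (A.baseChange K).charpoly = f.map (algebraMap R K)) : aeval A f = 0 := by
  have h := LinearMap.aeval_self_charpoly (A.baseChange K)
  rw [hA, aeval_baseChange] at h
  ext x
  apply Module.Flat.tensorProduct_mk_injective R P K
  simpa using LinearMap.congr_fun h (1 ⊗ₜ x)

theorem dvd_of_aeval_apply_eq_zero (hmonic : f.Monic)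
    (hirr : Irreducible (f.map (algebraMap R K))) {A : P →ₗ[R] P} (hA : aeval A f = 0)
    {x : P} (hx : x ≠ 0) {p : R[X]} (hp : aeval A p x = 0) : f ∣ p := by
  rw [← map_dvd_map _ (IsFractionRing.injective R K) hmonic]
  by_contra hdvd
  obtain ⟨a, b, hab⟩ := (hirr.coprime_iff_not_dvd.2 hdvd)
  apply hx
  apply Module.Flat.tensorProduct_mk_injective R P K
  have h := LinearMap.congr_fun (congrArg (aeval (A.baseChange K)) hab) (1 ⊗ₜ x)
  rw [map_add, map_mul, map_mul, aeval_baseChange, aeval_baseChange, hA] at h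
  simpa [hp] using h.symm

/-- An endomorphism killed by `f` is, up to isomorphism, multiplication by the class of `X` on
some nonzero ideal of `R[X] ⧸ (f)`. -/
theorem exists_ideal_linearEquiv [IsDomain R] [Module.Finite R P] (hmonic : f.Monic)
    (hirr : Irreducible (f.map (algebraMap R K))) (hrank : Module.finrank R P = f.natDegree)
    {A : P →ₗ[R] P} (hA : aeval A f = 0) :
    ∃ (I : Ideal (R[X] ⧸ Ideal.span {f})) (e : I ≃ₗ[R] P), I ≠ ⊥ ∧
      ∀ y, e (Ideal.Quotient.mk (Ideal.span {f}) X • y) = A (e y) := by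
  have hpos : 0 < f.natDegree := by
    rw [← hmonic.natDegree_map (algebraMap R K)]
    exact hirr.natDegree_pos
  have : Nontrivial P := Module.nontrivial_of_finrank_pos (R := R) (hrank ▸ hpos)
  obtain ⟨x, hx⟩ := exists_ne (0 : P)
  let ρ : (R[X] ⧸ Ideal.span {f}) →ₐ[R] Module.End R P :=
    Ideal.Quotient.liftₐ (Ideal.span {f}) (aeval A) fun a ha => by
      obtain ⟨b, rfl⟩ := Ideal.mem_span_singleton.1 ha
      rw [map_mul, hA, zero_mul]
  have hρX : ρ (Ideal.Quotient.mk (Ideal.span {f}) X) = A := aeval_X A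
  let φ : (R[X] ⧸ Ideal.span {f}) →ₗ[R] P := LinearMap.applyₗ x ∘ₗ ρ.toLinearMap
  have hφmul : ∀ s t, φ (s * t) = ρ s (φ t) := fun s t => by simp [φ]
  have hφ : Function.Injective φ := by
    rw [injective_iff_map_eq_zero]
    intro s hs
    obtain ⟨p, rfl⟩ := Ideal.Quotient.mk_surjective s
    rw [Ideal.Quotient.eq_zero_iff_mem, Ideal.mem_span_singleton]
    exact dvd_of_aeval_apply_eq_zero K hmonic hirr hA hx hs
  obtain ⟨d, hd, hd0⟩ : ∃ d : R, (∀ y, ∃ s, φ s = d • y) ∧ d ≠ 0 := by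
    have htors : Module.IsTorsion R (P ⧸ LinearMap.range φ) := by
      rw [← Module.finrank_eq_zero_iff_isTorsion]
      have := Submodule.finrank_quotient_add_finrank (LinearMap.range φ)
      rw [LinearMap.finrank_range_of_inj hφ, finrank_quotient_span_eq_natDegree' hmonic,
        hrank] at this
      omega
    obtain ⟨d, hd, hd0⟩ := Submodule.annihilator_top_inter_nonZeroDivisors htors
    refine ⟨d, fun y => ?_, nonZeroDivisors.ne_zero hd0⟩
    have := Submodule.mem_annihilator.1 hd (Submodule.Quotient.mk y) trivial
    rwa [← Submodule.Quotient.mk_smul, Submodule.Quotient.mk_eq_zero] at this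
  choose h hh using hd
  have hsmul : ∀ s y, h (ρ s y) = s * h y := fun s y => hφ (by simp [hh, hφmul])
  let h' : P →ₗ[R] (R[X] ⧸ Ideal.span {f}) :=
    { toFun := h
      map_add' := fun y z => hφ (by simp [hh])
      map_smul' := fun a y => hφ (by simp [hh, smul_comm a d]) }
  have hinj : Function.Injective h' := by
    intro y z hyz
    have : d • y = d • z := by rw [← hh, ← hh]; exact congrArg φ hyz
    exact smul_right_injective P hd0 this
  let I : Ideal (R[X] ⧸ Ideal.span {f}) :=
    { (LinearMap.range h').toAddSubmonoid with
      smul_mem' := by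
        rintro s _ ⟨y, rfl⟩
        exact ⟨ρ s y, hsmul s y⟩ }
  let e : P ≃ₗ[R] I := LinearEquiv.ofInjective h' hinj
  refine ⟨I, e.symm, ?_, fun y => ?_⟩
  · intro hI
    have hmem : h' x ∈ I := ⟨x, rfl⟩
    rw [hI, Submodule.mem_bot] at hmem
    exact hx (hinj (hmem.trans (map_zero h').symm))
  · obtain ⟨y, rfl⟩ := e.surjective y
    rw [LinearEquiv.symm_apply_eq, LinearEquiv.symm_apply_apply]
    apply Subtype.ext
    have := hsmul (Ideal.Quotient.mk (Ideal.span {f}) X) y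
    rw [hρX] at this
    exact this.symm

end FractionField

end EndomorphismIdealClass

/-- **Conjugacy classes of endomorphisms of a projective module and ideal classes.**
Let `K` be a number field, `f ∈ (𝓞 K)[t]` monic of degree `m` and irreducible over `K`, and
`P` a finitely generated projective `𝓞 K`-module of rank `m`.  The conjugacy classes (under
`Aut_{𝓞 K}(P)`) of `𝓞 K`-endomorphisms of `P` whose characteristic polynomial (that of the
induced `K`-endomorphism of `P ⊗ K`) is `f` are in bijection with the isomorphism classes
(as `(𝓞 K)[t]/(f)`-modules) of nonzero ideals of `(𝓞 K)[t]/(f)` that are isomorphic to `P`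
as `𝓞 K`-modules. -/
theorem conjugacy_classes_of_endomorphisms_equiv_ideal_classes
    (K : Type*) [Field K] [NumberField K]
    (m : ℕ) (f : (𝓞 K)[X]) (hmonic : f.Monic) (hdeg : f.natDegree = m)
    (hirr : Irreducible (f.map (algebraMap (𝓞 K) K)))
    (P : Type*) [AddCommGroup P] [Module (𝓞 K) P] [Module.Finite (𝓞 K) P]
    [Module.Projective (𝓞 K) P] (hrank : Module.finrank (𝓞 K) P = m) :
    Nonempty
      ((Quot fun A B : {A : P →ₗ[𝓞 K] P //
            (LinearMap.baseChange K A).charpoly = f.map (algebraMap (𝓞 K) K)} =>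
          ∃ U : P ≃ₗ[𝓞 K] P, U.conj (A : P →ₗ[𝓞 K] P) = (B : P →ₗ[𝓞 K] P)) ≃
        (Quot fun I J : {I : Ideal ((𝓞 K)[X] ⧸ Ideal.span {f}) //
            I ≠ ⊥ ∧ Nonempty ((I : Ideal ((𝓞 K)[X] ⧸ Ideal.span {f})) ≃ₗ[𝓞 K] P)} =>
          Nonempty
            ((I : Ideal ((𝓞 K)[X] ⧸ Ideal.span {f})) ≃ₗ[(𝓞 K)[X] ⧸ Ideal.span {f}]
              (J : Ideal ((𝓞 K)[X] ⧸ Ideal.span {f}))))) := by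
  open EndomorphismIdealClass in
  subst hdeg
  refine Quot.nonempty_equiv_of_correspondence
    (fun A I => ∃ e : (I : Ideal ((𝓞 K)[X] ⧸ Ideal.span {f})) ≃ₗ[𝓞 K] P,
      ∀ y, e (Ideal.Quotient.mk (Ideal.span {f}) Polynomial.X • y) = (A : P →ₗ[𝓞 K] P) (e y))
    (fun A => ⟨.refl _ _, by ext; simp [LinearEquiv.conj_apply]⟩) (fun I => ⟨.refl _ _⟩) ?_ ?_ ?_
  · rintro ⟨A, hA⟩
    obtain ⟨I, e, hI, he⟩ := exists_ideal_linearEquiv K hmonic hirr hrank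
      (aeval_eq_zero_of_charpoly_baseChange K hA)
    exact ⟨⟨I, hI, ⟨e⟩⟩, e, he⟩
  · rintro ⟨I, hI, ⟨e⟩⟩
    let A : P →ₗ[𝓞 K] P := e.conj
      (LinearMap.lsmul ((𝓞 K)[X] ⧸ Ideal.span {f}) I
        (Ideal.Quotient.mk (Ideal.span {f}) Polynomial.X) |>.restrictScalars (𝓞 K))
    have he : ∀ y, e (Ideal.Quotient.mk (Ideal.span {f}) Polynomial.X • y) = A (e y) := by
      intro y
      simp [A, LinearEquiv.conj_apply]
    exact ⟨⟨A, charpoly_baseChange_eq K hmonic hirr hrank A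
      (aeval_eq_zero_of_linearEquiv e he)⟩, e, he⟩
  · rintro A B I J ⟨e, he⟩ ⟨e', he'⟩
    exact conj_iff_nonempty_linearEquiv e e' he he'
end

section
/- Let K be a number field with ring of integers O_K, and let f ∈ O_K[t] be a monic polynomial of degree m such that f(0) is a unit of O_K and f has no repeated roots in an algebraic closure of K. Then the set of matrices A ∈ M_m(O_K) with characteristic polynomial equal to f, taken up to conjugation by GL_m(O_K), is finite; in particular there are only finitely many conjugacy classes of elements of GL_m(O_K) with characteristic polynomial f. -/
open scoped NumberField Polynomial

section

open scoped nonZeroDivisors Matrix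

universe u

/-- Up to scaling, a number field has only finitely many finitely generated modules over its
ring of integers (a form of the finiteness of the class group). -/
theorem exists_finite_fg_submodule_representatives (L : Type*) [Field L] [NumberField L] :
    ∃ F : Set (Submodule (𝓞 L) L), F.Finite ∧ (∀ I ∈ F, I.FG) ∧
      ∀ J : Submodule (𝓞 L) L, J.FG → ∃ I ∈ F, ∃ u : Lˣ, ∀ x, x ∈ J ↔ u * x ∈ I := by
  let Q := (FractionalIdeal (𝓞 L)⁰ L)ˣ ⧸ (toPrincipalIdeal (𝓞 L) L).range
  have : Finite Q := Finite.of_equiv _ (ClassGroup.equiv (R := 𝓞 L) L).toEquiv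
  let r : Q → Submodule (𝓞 L) L := fun q ↦ ((q.out : FractionalIdeal (𝓞 L)⁰ L) : Submodule _ _)
  refine ⟨insert ⊥ (Set.range r), (Set.finite_range r).insert _, ?_, fun J hJ ↦ ?_⟩
  · rintro I (rfl | ⟨q, rfl⟩)
    · exact Submodule.fg_bot
    · exact FractionalIdeal.fg_unit _
  · by_cases hJ0 : J = ⊥
    · exact ⟨⊥, by simp, 1, by simp [hJ0]⟩
    let J' : FractionalIdeal (𝓞 L)⁰ L := ⟨J, FractionalIdeal.isFractional_of_fg hJ⟩
    have hJ' : J' ≠ 0 := fun h ↦ hJ0 (by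
      simpa [J'] using congrArg (fun I : FractionalIdeal (𝓞 L)⁰ L ↦ (I : Submodule (𝓞 L) L)) h)
    let U := Units.mk0 J' hJ'
    let q : Q := QuotientGroup.mk U
    obtain ⟨u, hu⟩ := QuotientGroup.eq.1 (Quotient.out_eq q).symm
    have hout : (q.out : FractionalIdeal (𝓞 L)⁰ L) =
        FractionalIdeal.spanSingleton _ (u : L) * J' := by
      rw [← coe_toPrincipalIdeal, hu]
      change _ = ((U⁻¹ * q.out : (FractionalIdeal (𝓞 L)⁰ L)ˣ) : FractionalIdeal (𝓞 L)⁰ L) *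
        (U : FractionalIdeal (𝓞 L)⁰ L)
      rw [← Units.val_mul, mul_right_comm, inv_mul_cancel, one_mul]
    refine ⟨r q, Or.inr ⟨q, rfl⟩, u, fun x ↦ ?_⟩
    change _ ↔ (u : L) * x ∈ (q.out : FractionalIdeal (𝓞 L)⁰ L)
    rw [hout, FractionalIdeal.mem_singleton_mul]
    constructor
    · exact fun hx ↦ ⟨x, hx, rfl⟩
    · rintro ⟨y, hy, h⟩
      rwa [mul_left_cancel₀ u.ne_zero h]

/-- There are finitely many subgroups between `d • W` and `W` for `W` finitely generated. -/
theorem AddSubgroup.FG.finite_setOf_zsmul_mem_of_le {E : Type*} [AddCommGroup E]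
    {W : AddSubgroup E} (hW : W.FG) {d : ℤ} (hd : d ≠ 0) :
    {N : AddSubgroup E | N ≤ W ∧ ∀ x ∈ W, d • x ∈ N}.Finite := by
  let D : AddSubgroup W := (zsmulAddGroupHom d : W →+ W).range
  have : AddGroup.FG W := (AddGroup.fg_iff_addSubgroup_fg W).2 hW
  have : Finite (W ⧸ D) := by
    refine AddCommGroup.finite_of_fg_isAddTorsion _ fun x ↦ ?_
    obtain ⟨y, rfl⟩ := QuotientAddGroup.mk_surjective x
    rw [isOfFinAddOrder_iff_zsmul_eq_zero]
    refine ⟨d, hd, ?_⟩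
    rw [← QuotientAddGroup.mk_zsmul, QuotientAddGroup.eq_zero_iff]
    exact ⟨y, rfl⟩
  refine Set.Finite.of_finite_image (f := fun N : AddSubgroup E ↦
    (N.addSubgroupOf W).map (QuotientAddGroup.mk' D)) (Set.toFinite _) ?_
  have key : ∀ N : AddSubgroup E, N ≤ W ∧ (∀ x ∈ W, d • x ∈ N) →
      (((N.addSubgroupOf W).map (QuotientAddGroup.mk' D)).comap (QuotientAddGroup.mk' D)).map
        W.subtype = N := by
    rintro N ⟨hN, hdN⟩
    rw [AddSubgroup.comap_map_eq_self, AddSubgroup.addSubgroupOf_map_subtype, inf_eq_left.2 hN]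
    rw [QuotientAddGroup.ker_mk']
    rintro _ ⟨y, rfl⟩
    exact hdN y y.2
  intro N hN N' hN' h
  rw [← key N hN, ← key N' hN']
  exact congrArg (fun X ↦ (X.comap (QuotientAddGroup.mk' D)).map W.subtype) h

theorem exists_ne_zero_forall_zsmul_mem {E : Type*} [AddCommGroup E]
    {O S : AddSubgroup E} (hO : O.FG) (hS : ∀ x, ∃ n : ℤ, n ≠ 0 ∧ n • x ∈ S) :
    ∃ d : ℤ, d ≠ 0 ∧ ∀ x ∈ O, d • x ∈ S := by
  obtain ⟨s, rfl⟩ := hO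
  choose n hn hnS using hS
  refine ⟨∏ x ∈ s, n x, Finset.prod_ne_zero_iff.2 fun x _ ↦ hn x, fun x hx ↦ ?_⟩
  induction hx using AddSubgroup.closure_induction with
  | mem x hx =>
    obtain ⟨c, hc⟩ := Finset.dvd_prod_of_mem n hx
    rw [hc, mul_comm, mul_smul]
    exact S.zsmul_mem (hnS x) c
  | zero => simp
  | add x y _ _ hx hy => rw [smul_add]; exact S.add_mem hx hy
  | neg x _ hx => rw [smul_neg]; exact S.neg_mem hx

theorem NumberField.fg_toAddSubgroup {L : Type*} [Field L] [NumberField L]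
    {J : Submodule (𝓞 L) L} (hJ : J.FG) : J.toAddSubgroup.FG := by
  have : Module.Finite (𝓞 L) J := Module.Finite.iff_fg.2 hJ
  have : Module.Finite ℤ J := Module.Finite.trans (𝓞 L) J
  have h : (J.restrictScalars ℤ).FG := Module.Finite.iff_fg.1 this
  rwa [Submodule.fg_iff_addSubgroup_fg] at h

/-- Finiteness, up to scaling by units, of the finitely generated subgroups of a product of number
fields that are stable under a fixed subgroup `S` of full rank. -/
theorem exists_finite_lattice_representatives {ι : Type*} [Finite ι] (L : ι → Type*)
    [∀ i, Field (L i)] [∀ i, NumberField (L i)] {S : AddSubgroup (∀ i, L i)}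
    (hS : ∀ x, ∃ n : ℤ, n ≠ 0 ∧ n • x ∈ S) :
    ∃ T : Set (AddSubgroup (∀ i, L i)), T.Finite ∧
      ∀ M : AddSubgroup (∀ i, L i), M.FG → (∀ s ∈ S, ∀ x ∈ M, s * x ∈ M) →
        ∃ N ∈ T, ∃ u : (∀ i, L i)ˣ, ∀ x, x ∈ M ↔ ↑u * x ∈ N := by
  classical
  have := Fintype.ofFinite ι
  choose F hFfin hFfg hF using fun i ↦ exists_finite_fg_submodule_representatives (L i)
  let O : AddSubgroup (∀ i, L i) :=
    AddSubgroup.pi Set.univ fun i ↦ (1 : Submodule (𝓞 (L i)) (L i)).toAddSubgroup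
  have hO : O.FG := AddSubgroup.FG.pi fun i ↦ NumberField.fg_toAddSubgroup
    (by rw [Submodule.one_eq_span]; exact Submodule.fg_span_singleton _)
  obtain ⟨d, hd, hdS⟩ := exists_ne_zero_forall_zsmul_mem hO hS
  let W (I : ∀ i, Submodule (𝓞 (L i)) (L i)) : AddSubgroup (∀ i, L i) :=
    AddSubgroup.pi Set.univ fun i ↦ (I i).toAddSubgroup
  refine ⟨⋃ I ∈ Set.pi Set.univ F, {N | N ≤ W I ∧ ∀ x ∈ W I, d • x ∈ N},
    (Set.Finite.pi hFfin).biUnion fun I hI ↦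
      AddSubgroup.FG.finite_setOf_zsmul_mem_of_le (AddSubgroup.FG.pi fun i ↦
        NumberField.fg_toAddSubgroup (hFfg i _ (hI i trivial))) hd, fun M hM hSM ↦ ?_⟩
  let J (i : ι) : Submodule (𝓞 (L i)) (L i) :=
    Submodule.span _ ((fun x : ∀ i, L i ↦ x i) '' M)
  have hJfg (i : ι) : (J i).FG := by
    obtain ⟨s, rfl⟩ := hM
    refine ⟨s.image fun x ↦ x i, le_antisymm (Submodule.span_mono ?_) (Submodule.span_le.2 ?_)⟩
    · rw [Finset.coe_image]
      exact Set.image_mono AddSubgroup.subset_closure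
    · rintro _ ⟨x, hx, rfl⟩
      induction hx using AddSubgroup.closure_induction with
      | mem x hx => exact Submodule.subset_span (by simpa using ⟨x, hx, rfl⟩)
      | zero => exact Submodule.zero_mem _
      | add x y _ _ hx hy => exact Submodule.add_mem _ hx hy
      | neg x _ hx => exact Submodule.neg_mem _ hx
  have hsingle (i : ι) (y : L i) (hy : y ∈ J i) (a : 𝓞 (L i)) :
      d • Pi.single i (a • y) ∈ M := by
    induction hy using Submodule.span_induction generalizing a with
    | mem y hy =>
      obtain ⟨x, hx, rfl⟩ := hy
      have ha : Pi.single i (a : L i) ∈ O := fun j _ ↦ by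
        rcases eq_or_ne j i with rfl | hj
        · rw [Pi.single_eq_same]
          exact Submodule.algebraMap_mem a
        · rw [Pi.single_eq_of_ne hj]
          exact Submodule.zero_mem _
      have h := hSM _ (hdS _ ha) x hx
      rwa [smul_mul_assoc, ← Pi.single_mul_left] at h
    | zero => simp
    | add y z _ _ hy hz => rw [smul_add, Pi.single_add, smul_add]; exact M.add_mem (hy a) (hz a)
    | smul b y _ hy => rw [smul_smul]; exact hy (a * b)
  have hdJ (x : ∀ i, L i) (hx : ∀ i, x i ∈ J i) : d • x ∈ M := by
    rw [← Finset.univ_sum_single x, Finset.smul_sum]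
    exact M.sum_mem fun i _ ↦ by simpa using hsingle i _ (hx i) 1
  choose I hIF u hu using fun i ↦ hF i (J i) (hJfg i)
  let v : (∀ i, L i)ˣ := MulEquiv.piUnits.symm u
  have hv (i : ι) : (v : ∀ i, L i) i = u i := rfl
  refine ⟨M.map (AddMonoidHom.mulLeft (v : ∀ i, L i)),
    Set.mem_biUnion (x := I) (fun i _ ↦ hIF i) ⟨?_, fun x hx ↦ ?_⟩, v, fun x ↦ ?_⟩
  · rintro _ ⟨x, hx, rfl⟩ i -
    exact (hu i _).1 (Submodule.subset_span ⟨x, hx, rfl⟩)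
  · refine ⟨d • ((↑v⁻¹ : ∀ i, L i) * x), hdJ _ fun i ↦ (hu i _).2 ?_, ?_⟩
    · rw [← hv, ← Pi.mul_apply, Units.mul_inv_cancel_left]
      exact hx i trivial
    · simp only [AddMonoidHom.coe_mulLeft, mul_smul_comm, Units.mul_inv_cancel_left]
  · constructor
    · exact fun hx ↦ ⟨x, hx, rfl⟩
    · rintro ⟨y, hy, h⟩
      rwa [← v.isUnit.mul_left_cancel h]

theorem LinearMap.aeval_mul_mem_range {R V E : Type*} [CommRing R] [AddCommGroup V] [Module R V]
    [CommRing E] [Algebra R E] {φ : V →ₗ[R] E} {a : V → V} {θ : E}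
    (h : ∀ v, φ (a v) = θ * φ v) (p : R[X]) (v : V) :
    Polynomial.aeval θ p * φ v ∈ LinearMap.range φ := by
  induction p using Polynomial.induction_on generalizing v with
  | C r => exact ⟨r • v, by rw [map_smul, Polynomial.aeval_C, Algebra.smul_def]⟩
  | add p q hp hq => rw [map_add, add_mul]; exact add_mem (hp v) (hq v)
  | monomial k r ih =>
    rw [pow_succ, ← mul_assoc, map_mul, Polynomial.aeval_X, mul_assoc, ← h]
    exact ih (a v)

/-- For `g` squarefree, `K[X] / (g)` is a product of number fields, generated by the class of `X`. -/
theorem exists_pi_numberField_generator {K : Type u} [Field K] [NumberField K] {g : K[X]}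
    (hg0 : g ≠ 0) (hg : Squarefree g) :
    ∃ (ι : Type u) (_ : Finite ι) (L : ι → Type u) (_ : ∀ i, Field (L i))
      (_ : ∀ i, NumberField (L i)) (_ : ∀ i, Algebra K (L i)) (θ : ∀ i, L i),
      Function.Surjective (Polynomial.aeval (R := K) θ) ∧
      (∀ i, Polynomial.aeval (θ i) g = 0) ∧
      Module.finrank K (∀ i, L i) = g.natDegree := by
  have : Module.Finite K (AdjoinRoot g) := (AdjoinRoot.powerBasis hg0).finite
  have : IsArtinianRing (AdjoinRoot g) := IsArtinianRing.of_finite K _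
  have : IsReduced (AdjoinRoot g) := by
    refine (Ideal.isRadical_iff_quotient_reduced _).1 ?_
    exact isRadical_iff_span_singleton.1 ((isRadical_iff_squarefree_of_ne_zero hg0).2 hg)
  let e : AdjoinRoot g ≃ₐ[K] ∀ I : MaximalSpectrum (AdjoinRoot g), AdjoinRoot g ⧸ I.asIdeal :=
    (IsArtinianRing.equivPi (AdjoinRoot g)).restrictScalars K
  let (I : MaximalSpectrum (AdjoinRoot g)) : Field (AdjoinRoot g ⧸ I.asIdeal) :=
    Ideal.Quotient.field _
  have (I : MaximalSpectrum (AdjoinRoot g)) : NumberField (AdjoinRoot g ⧸ I.asIdeal) :=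
    NumberField.of_module_finite K _
  refine ⟨MaximalSpectrum (AdjoinRoot g), inferInstance, fun I ↦ AdjoinRoot g ⧸ I.asIdeal,
    inferInstance, inferInstance, inferInstance, e (AdjoinRoot.root g), fun y ↦ ?_, fun i ↦ ?_, ?_⟩
  · obtain ⟨p, hp⟩ := AdjoinRoot.mk_surjective (e.symm y)
    refine ⟨p, ?_⟩
    rw [Polynomial.aeval_algHom_apply, AdjoinRoot.aeval_eq, hp, e.apply_symm_apply]
  · have h : Polynomial.aeval (e (AdjoinRoot.root g)) g = 0 := by
      rw [Polynomial.aeval_algHom_apply, AdjoinRoot.aeval_eq, AdjoinRoot.mk_self, map_zero]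
    have h' := congrArg (Pi.evalAlgHom K (fun I : MaximalSpectrum (AdjoinRoot g) ↦
      AdjoinRoot g ⧸ I.asIdeal) i) h
    rwa [← Polynomial.aeval_algHom_apply, map_zero] at h'
  · rw [← e.toLinearEquiv.finrank_eq]
    exact finrank_quotient_span_eq_natDegree

theorem Matrix.exists_ne_zero_vecMul_eq_smul {n F : Type*} [Fintype n] [DecidableEq n] [Field F]
    {A : Matrix n n F} {t : F} (h : A.charpoly.IsRoot t) : ∃ w ≠ 0, w ᵥ* A = t • w := by
  rw [Polynomial.IsRoot, Matrix.eval_charpoly] at h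
  obtain ⟨w, hw, hwA⟩ := Matrix.exists_vecMul_eq_zero_iff.2 h
  refine ⟨w, hw, ?_⟩
  rw [Matrix.vecMul_sub, sub_eq_zero] at hwA
  rw [← hwA]
  ext i
  simp [Matrix.scalar_apply, mul_comm]

/-- The left eigenvectors of `A` embed `n → K`, with the action of `A`, into a product of fields
generated by roots of the characteristic polynomial. -/
theorem Matrix.exists_injective_forall_mulVec_eq_mul {n K ι : Type*} [Fintype n] [DecidableEq n]
    [Field K] [Finite ι] {L : ι → Type*} [∀ i, Field (L i)] [∀ i, Algebra K (L i)]
    [∀ i, FiniteDimensional K (L i)]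
    {θ : ∀ i, L i} (hθ : Function.Surjective (Polynomial.aeval (R := K) θ)) {A : Matrix n n K}
    (hA : ∀ i, Polynomial.aeval (θ i) A.charpoly = 0)
    (hfin : Module.finrank K (∀ i, L i) = Fintype.card n) :
    ∃ ψ : (n → K) →ₗ[K] ∀ i, L i, Function.Injective ψ ∧ ∀ v, ψ (A *ᵥ v) = θ * ψ v := by
  classical
  have := Fintype.ofFinite ι
  have hroot (i : ι) : ∃ w : n → L i, w ≠ 0 ∧ w ᵥ* A.map (algebraMap K (L i)) = θ i • w := by
    apply Matrix.exists_ne_zero_vecMul_eq_smul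
    rw [Matrix.charpoly_map, Polynomial.IsRoot, Polynomial.eval_map_algebraMap, hA]
  choose w hw hwA using hroot
  let ψ : (n → K) →ₗ[K] ∀ i, L i := LinearMap.pi fun i ↦ Fintype.linearCombination K (w i)
  have hψ (v : n → K) (i : ι) : ψ v i = w i ⬝ᵥ (algebraMap K (L i) ∘ v) := by
    simp [ψ, Fintype.linearCombination_apply, dotProduct, Algebra.smul_def, mul_comm]
  have hψA (v : n → K) : ψ (A *ᵥ v) = θ * ψ v := by
    ext i
    rw [Pi.mul_apply, hψ, hψ, ← smul_eq_mul, ← smul_dotProduct, ← hwA, ← dotProduct_mulVec]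
    congr 1
    ext j
    exact RingHom.map_mulVec _ _ _ _
  have hmul (x : ∀ i, L i) (v : n → K) : x * ψ v ∈ LinearMap.range ψ := by
    obtain ⟨p, rfl⟩ := hθ x
    exact LinearMap.aeval_mul_mem_range hψA p v
  have hsurj : LinearMap.range ψ = ⊤ := by
    refine eq_top_iff.2 fun x _ ↦ ?_
    rw [← Finset.univ_sum_single x]
    refine Submodule.sum_mem _ fun i _ ↦ ?_
    obtain ⟨j, hj⟩ := Function.ne_iff.1 (hw i)
    have hv : ψ (Pi.single j 1) i = w i j := by simp [ψ]
    convert hmul (Pi.single i (x i * (w i j)⁻¹)) (Pi.single j 1) using 1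
    rw [← Pi.single_mul_left, hv, inv_mul_cancel_right₀ hj]
  refine ⟨ψ, ?_, hψA⟩
  exact (LinearMap.injective_iff_surjective_of_finrank_eq_finrank (by simp [hfin])).2
    (LinearMap.range_eq_top.1 hsurj)

/-- Matrices that act as multiplication by `θ` on the same submodule are conjugate. -/
theorem Matrix.exists_conj_eq_of_injective {n R E : Type*} [Fintype n] [DecidableEq n]
    [CommRing R] [CommRing E] [Algebra R E] {A B : Matrix n n R} {θ : E}
    {φ χ : (n → R) →ₗ[R] E} (hφ : Function.Injective φ) (hχ : Function.Injective χ)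
    (hφA : ∀ v, φ (A *ᵥ v) = θ * φ v) (hχB : ∀ v, χ (B *ᵥ v) = θ * χ v)
    (h : LinearMap.range φ = LinearMap.range χ) :
    ∃ P : GL n R, (P : Matrix n n R) * A * ((P⁻¹ : GL n R) : Matrix n n R) = B := by
  let e : (n → R) ≃ₗ[R] (n → R) := (LinearEquiv.ofInjective φ hφ).trans
    ((LinearEquiv.ofEq _ _ h).trans (LinearEquiv.ofInjective χ hχ).symm)
  have he (v : n → R) : χ (e v) = φ v := by
    have h := LinearEquiv.apply_symm_apply (LinearEquiv.ofInjective χ hχ)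
      (LinearEquiv.ofEq _ _ h (LinearEquiv.ofInjective φ hφ v))
    exact congrArg Subtype.val h
  let P : GL n R := ⟨LinearMap.toMatrix' e.toLinearMap, LinearMap.toMatrix' e.symm.toLinearMap,
    by rw [← LinearMap.toMatrix'_comp]; simp, by rw [← LinearMap.toMatrix'_comp]; simp⟩
  have hP (v : n → R) : (P : Matrix n n R) *ᵥ v = e v := LinearMap.toMatrix'_mulVec _ _
  refine ⟨P, ?_⟩
  have hPA : (P : Matrix n n R) * A = B * P := by
    refine Matrix.ext_of_mulVec_single fun j ↦ hχ ?_
    rw [← Matrix.mulVec_mulVec, ← Matrix.mulVec_mulVec, hP, hP, he, hφA, hχB, he]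
  rw [hPA, mul_assoc, ← Units.val_mul, mul_inv_cancel, Units.val_one, mul_one]

theorem NumberField.exists_aeval_eq_zsmul {K E : Type*} [Field K] [NumberField K]
    [CommRing E] [Algebra K E] {θ : E}
    (hθ : Function.Surjective (Polynomial.aeval (R := K) θ)) (x : E) :
    ∃ n : ℤ, n ≠ 0 ∧ ∃ p : (𝓞 K)[X], Polynomial.aeval θ p = n • x := by
  obtain ⟨q, rfl⟩ := hθ x
  obtain ⟨_, ⟨n, hn, rfl⟩, hnq⟩ := IsLocalization.integerNormalization_spec
    (Algebra.algebraMapSubmonoid (𝓞 K) ℤ⁰) q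
  refine ⟨n, nonZeroDivisors.ne_zero hn, IsLocalization.integerNormalization
    (Algebra.algebraMapSubmonoid (𝓞 K) ℤ⁰) q, ?_⟩
  rw [← Polynomial.aeval_map_algebraMap K, hnq, algebraMap_smul, map_zsmul]

theorem Matrix.finite_quot_conj_of_finite_lattice_representatives {R E n : Type*} [CommRing R]
    [Module.Finite ℤ R] [CommRing E] [Algebra R E] [Fintype n] [DecidableEq n] {f : R[X]} {θ : E}
    {T : Set (AddSubgroup E)} (hTfin : T.Finite)
    (hT : ∀ M : AddSubgroup E, M.FG →
      (∀ s ∈ (Polynomial.aeval (R := R) θ).toRingHom.toAddMonoidHom.range, ∀ x ∈ M, s * x ∈ M) →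
        ∃ N ∈ T, ∃ u : Eˣ, ∀ x, x ∈ M ↔ ↑u * x ∈ N)
    (hf : ∀ A : Matrix n n R, A.charpoly = f →
      ∃ φ : (n → R) →ₗ[R] E, Function.Injective φ ∧ ∀ v, φ (A *ᵥ v) = θ * φ v) :
    Finite (Quot fun A B : {A : Matrix n n R // A.charpoly = f} =>
      ∃ P : GL n R, (P : Matrix n n R) * (A : Matrix n n R) *
        ((P⁻¹ : GL n R) : Matrix n n R) = (B : Matrix n n R)) := by
  choose φ hφ hφA using fun A : {A : Matrix n n R // A.charpoly = f} ↦ hf A.1 A.2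
  have hfg (A) : (LinearMap.range (φ A)).toAddSubgroup.FG := by
    have h : (LinearMap.range ((φ A).restrictScalars ℤ)).FG := by
      rw [← Submodule.map_top]
      exact Module.Finite.fg_top.map _
    rwa [Submodule.fg_iff_addSubgroup_fg] at h
  have hmul (A) (s) (hs : s ∈ (Polynomial.aeval (R := R) θ).toRingHom.toAddMonoidHom.range)
      (x) (hx : x ∈ (LinearMap.range (φ A)).toAddSubgroup) :
      s * x ∈ (LinearMap.range (φ A)).toAddSubgroup := by
    obtain ⟨p, rfl⟩ := hs
    obtain ⟨v, rfl⟩ := hx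
    exact LinearMap.aeval_mul_mem_range (hφA A) p v
  choose N hNT u hu using fun A ↦ hT _ (hfg A) (hmul A)
  have := hTfin.to_subtype
  refine Finite.of_injective (β := T) (fun q ↦ ⟨N q.out, hNT q.out⟩) fun q q' h ↦ ?_
  rw [← q.out_eq, ← q'.out_eq]
  apply Quot.sound
  have hN : N q.out = N q'.out := congrArg Subtype.val h
  generalize q.out = A at hN ⊢
  generalize q'.out = B at hN ⊢
  refine Matrix.exists_conj_eq_of_injective (θ := θ)
    (φ := LinearMap.mulLeft R (↑(u A) : E) ∘ₗ φ A) (χ := LinearMap.mulLeft R (↑(u B) : E) ∘ₗ φ B)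
    ((u A).isUnit.mul_right_injective.comp (hφ A)) ((u B).isUnit.mul_right_injective.comp (hφ B))
    (fun v ↦ by simp [hφA, mul_left_comm]) (fun v ↦ by simp [hφA, mul_left_comm]) ?_
  have hrange (C) (x : E) : x ∈ LinearMap.range (LinearMap.mulLeft R (↑(u C) : E) ∘ₗ φ C) ↔
      x ∈ N C := by
    rw [← Units.mul_inv_cancel_left (u C) x, ← hu]
    constructor
    · rintro ⟨v, hv⟩
      exact ⟨v, (u C).isUnit.mul_left_cancel hv⟩
    · rintro ⟨v, hv⟩
      exact ⟨v, congrArg ((u C : E) * ·) hv⟩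
  ext x
  rw [hrange, hrange, hN]

theorem Polynomial.squarefree_of_squarefree_map {F F' : Type*} [Field F] [Field F'] (i : F →+* F')
    {p : F[X]} (hp : Squarefree (p.map i)) : Squarefree p := fun q hq ↦ by
  have h := hp (q.map i) (by rw [← Polynomial.map_mul]; exact Polynomial.map_dvd i hq)
  rw [Polynomial.isUnit_iff_degree_eq_zero] at h ⊢
  rwa [Polynomial.degree_map] at h

end

/-- **Finiteness of conjugacy classes with fixed separable characteristic polynomial.**
Let `K` be a number field with ring of integers `𝓞 K`, and let `f ∈ (𝓞 K)[t]` be a monic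
polynomial of degree `m` with `f(0)` a unit and without repeated roots in an algebraic
closure of `K` (i.e. `f` is squarefree over the algebraic closure).  Then there are only
finitely many matrices in `M_m (𝓞 K)` with characteristic polynomial `f`, up to conjugation
by `GL_m (𝓞 K)`. -/
theorem finite_conjugacy_classes_of_separable_charpoly
    (K : Type*) [Field K] [NumberField K]
    (m : ℕ) (f : (𝓞 K)[X]) (hmonic : f.Monic) (hdeg : f.natDegree = m)
    (hunit : IsUnit (f.coeff 0))
    (hsep : Squarefree ((f.map (algebraMap (𝓞 K) K)).map
      (algebraMap K (AlgebraicClosure K)))) :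
    Finite
      (Quot fun A B : {A : Matrix (Fin m) (Fin m) (𝓞 K) // A.charpoly = f} =>
        ∃ P : GL (Fin m) (𝓞 K),
          (P : Matrix (Fin m) (Fin m) (𝓞 K)) * (A : Matrix (Fin m) (Fin m) (𝓞 K)) *
              ((P⁻¹ : GL (Fin m) (𝓞 K)) : Matrix (Fin m) (Fin m) (𝓞 K)) =
            (B : Matrix (Fin m) (Fin m) (𝓞 K))) := by
  have hsq := Polynomial.squarefree_of_squarefree_map _ hsep
  have hmonic' := hmonic.map (algebraMap (𝓞 K) K)
  obtain ⟨ι, _, L, _, _, _, θ, hθ, hroot, hfin⟩ :=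
    exists_pi_numberField_generator hmonic'.ne_zero hsq
  rw [hmonic.natDegree_map, hdeg] at hfin
  obtain ⟨T, hTfin, hT⟩ := exists_finite_lattice_representatives L
    (S := (Polynomial.aeval (R := 𝓞 K) θ).toRingHom.toAddMonoidHom.range) fun x ↦ by
      obtain ⟨n, hn, p, hp⟩ := NumberField.exists_aeval_eq_zsmul hθ x
      exact ⟨n, hn, p, hp⟩
  refine Matrix.finite_quot_conj_of_finite_lattice_representatives hTfin hT fun A hA ↦ ?_
  have hchar : (A.map (algebraMap (𝓞 K) K)).charpoly = f.map (algebraMap (𝓞 K) K) := by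
    rw [Matrix.charpoly_map, hA]
  obtain ⟨ψ, hψ, hψA⟩ := Matrix.exists_injective_forall_mulVec_eq_mul hθ
    (A := A.map (algebraMap (𝓞 K) K)) (fun i ↦ by rw [hchar]; exact hroot i) (by simpa using hfin)
  refine ⟨ψ.restrictScalars (𝓞 K) ∘ₗ (Algebra.linearMap (𝓞 K) K).compLeft (Fin m),
    hψ.comp ((NumberField.RingOfIntegers.coe_injective).comp_left), fun v ↦ ?_⟩
  refine Eq.trans (congrArg ψ ?_) (hψA _)
  ext j
  exact RingHom.map_mulVec (algebraMap (𝓞 K) K) _ _ _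
end

section
/- Every element of finite order in GL_3(ℤ) is conjugate in GL_3(ℤ) to exactly one of the following sixteen matrices (so no two distinct members of the list are conjugate): I₃; −I₃; diag(1,1,−1); [[1,0,1],[0,1,0],[0,0,−1]]; diag(−1,−1,1); [[−1,0,−1],[0,−1,0],[0,0,1]]; [[0,1,0],[−1,−1,0],[0,0,1]]; [[0,1,1],[−1,−1,0],[0,0,1]]; [[0,−1,0],[1,1,0],[0,0,−1]]; [[0,−1,−1],[1,1,0],[0,0,−1]]; [[0,1,0],[−1,−1,0],[0,0,−1]]; [[0,−1,0],[1,1,0],[0,0,1]]; [[0,1,0],[−1,0,0],[0,0,1]]; [[0,1,1],[−1,0,0],[0,0,1]]; [[0,−1,0],[1,0,0],[0,0,−1]]; and [[0,−1,−1],[1,0,0],[0,0,−1]]. -/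
open Matrix

namespace GL3ZTorsion

theorem isConj_of_isUnit_det {n : Type*} [Fintype n] [DecidableEq n] {R : Type*} [CommRing R]
    {A B : Matrix n n R} (P : Matrix n n R) (hP : IsUnit P.det) (h : P * A = B * P) :
    IsConj A B :=
  ⟨((Matrix.isUnit_iff_isUnit_det P).2 hP).unit, h⟩

theorem pow_eq_one_of_isConj {M : Type*} [Monoid M] {a b : M} (h : IsConj a b) {n : ℕ}
    (ha : a ^ n = 1) : b ^ n = 1 := by
  simpa [ha, isConj_one_right, eq_comm] using h.pow n

theorem isConj_neg {R : Type*} [Ring R] {a b : R} (h : IsConj a b) : IsConj (-a) (-b) := by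
  obtain ⟨c, hc⟩ := h
  exact ⟨c, hc.neg_right⟩

/-! ### Square-zero perturbations of the identity -/

theorem one_add_pow_of_mul_self_eq_zero {R : Type*} [Ring R] {N : R} (hN : N * N = 0) (n : ℕ) :
    (1 + N) ^ n = 1 + n • N := by
  induction n with
  | zero => simp
  | succ n ih =>
    rw [pow_succ, ih, mul_add, mul_one, add_mul, smul_mul_assoc, hN, succ_nsmul]
    simp [add_assoc]

theorem eq_zero_of_one_add_pow_eq_one {m : Type*} [Fintype m] [DecidableEq m]
    {N : Matrix m m ℤ} (hN : N * N = 0) {n : ℕ} (hn : 0 < n) (h : (1 + N) ^ n = 1) : N = 0 := by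
  rw [one_add_pow_of_mul_self_eq_zero hN, add_eq_left] at h
  ext i j
  have := congrFun (congrFun h i) j
  simpa [hn.ne'] using this

/-! ### Torsion in `SL₂(ℤ)` -/

section TwoByTwo

variable {B : Matrix (Fin 2) (Fin 2) ℤ}

theorem mul_self_eq_trace_smul_sub_one (hB : B.det = 1) : B * B = B.trace • B - 1 := by
  rw [det_fin_two] at hB
  ext i j
  fin_cases i <;> fin_cases j <;>
    simp [mul_apply, Fin.sum_univ_two, trace_fin_two, -zsmul_eq_mul] <;> linarith

theorem trace_pow_add_two (hB : B.det = 1) (k : ℕ) :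
    (B ^ (k + 2)).trace = B.trace * (B ^ (k + 1)).trace - (B ^ k).trace := by
  rw [pow_add, pow_two, mul_self_eq_trace_smul_sub_one hB, mul_sub, mul_smul_comm, ← pow_succ]
  rw [trace_sub, trace_smul, smul_eq_mul, mul_one]

theorem abs_trace_pow_lt (hB : B.det = 1) (ht : 2 < |B.trace|) (k : ℕ) :
    2 ≤ |(B ^ k).trace| ∧ |(B ^ k).trace| < |(B ^ (k + 1)).trace| := by
  induction k with
  | zero => simpa [trace_one] using ht
  | succ k ih =>
    obtain ⟨h₁, h₂⟩ := ih
    refine ⟨by omega, ?_⟩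
    rw [trace_pow_add_two hB]
    have h₃ := abs_sub_abs_le_abs_sub (B.trace * (B ^ (k + 1)).trace) (B ^ k).trace
    rw [abs_mul] at h₃
    nlinarith

theorem abs_trace_le_two (hB : B.det = 1) {n : ℕ} (hn : 0 < n) (h : B ^ n = 1) :
    |B.trace| ≤ 2 := by
  by_contra! ht
  obtain ⟨k, rfl⟩ := Nat.exists_eq_succ_of_ne_zero hn.ne'
  obtain ⟨h₁, h₂⟩ := abs_trace_pow_lt hB ht k
  rw [Nat.succ_eq_add_one] at h
  rw [h, trace_one] at h₂
  simp at h₂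
  omega

theorem eq_one_of_trace_eq_two (hB : B.det = 1) {n : ℕ} (hn : 0 < n) (h : B ^ n = 1)
    (ht : B.trace = 2) : B = 1 := by
  rw [← sub_eq_zero]
  refine eq_zero_of_one_add_pow_eq_one ?_ hn (by simpa using h)
  have := mul_self_eq_trace_smul_sub_one hB
  rw [ht] at this
  rw [sub_mul, mul_sub, this, two_smul]
  simp only [mul_one, one_mul]
  abel

theorem eq_neg_one_of_trace_eq_neg_two (hB : B.det = 1) {n : ℕ} (hn : 0 < n) (h : B ^ n = 1)
    (ht : B.trace = -2) : B = -1 := by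
  rw [← neg_eq_iff_eq_neg]
  refine eq_one_of_trace_eq_two (by simp [det_neg, hB]) (n := 2 * n) (by omega) ?_
    (by simp [ht])
  rw [pow_mul, neg_sq, ← pow_mul, mul_comm, pow_mul, h, one_pow]

/-- Conjugation by a shear translates the upper left entry by a multiple of the lower left one. -/
theorem isConj_shear (a b c d k : ℤ) :
    IsConj !![a, b; c, d] !![a + k * c, b + k * d - k * (a + k * c); c, d - k * c] := by
  refine isConj_of_isUnit_det !![1, k; 0, 1] (by simp [det_fin_two]) ?_
  ext i j
  fin_cases i <;> fin_cases j <;> simp [mul_apply, Fin.sum_univ_two] <;> ring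

theorem isConj_swap (a b c d : ℤ) : IsConj !![a, b; c, d] !![d, c; b, a] := by
  refine isConj_of_isUnit_det !![0, 1; 1, 0] (by simp [det_fin_two]) ?_
  ext i j
  fin_cases i <;> fin_cases j <;> simp [mul_apply, Fin.sum_univ_two]

theorem isConj_flip (a b c d : ℤ) : IsConj !![a, b; c, d] !![a, -b; -c, d] := by
  refine isConj_of_isUnit_det !![1, 0; 0, -1] (by simp [det_fin_two]) ?_
  ext i j
  fin_cases i <;> fin_cases j <;> simp [mul_apply, Fin.sum_univ_two]

theorem exists_two_mul_add_abs_le (a t : ℤ) {c : ℤ} (hc : c ≠ 0) :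
    ∃ k : ℤ, |2 * (a + k * c) - t| ≤ |c| := by
  have h₁ := Int.emod_nonneg (2 * a - t + |c|) (b := 2 * c) (by omega)
  have h₂ := Int.emod_lt_abs (2 * a - t + |c|) (b := 2 * c) (by omega)
  have h₃ := Int.emod_add_mul_ediv (2 * a - t + |c|) (2 * c)
  refine ⟨-((2 * a - t + |c|) / (2 * c)), ?_⟩
  rw [abs_mul, abs_two] at h₂
  rw [abs_le]
  constructor <;> linarith

/-- Reduction theory: an elliptic matrix in `SL₂(ℤ)` is conjugate in `GL₂(ℤ)` to the companion
matrix of its characteristic polynomial. -/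
theorem isConj_companion_of_entries {t : ℤ} (ht : |t| < 2) :
    ∀ (m : ℕ) (a b c d : ℤ), c.natAbs ≤ m → a + d = t → a * d - b * c = 1 →
      IsConj !![a, b; c, d] !![0, 1; -1, t] := by
  rw [abs_lt] at ht
  intro m
  induction m with
  | zero =>
    intro a b c d hc htr hdet
    obtain rfl : c = 0 := by omega
    obtain rfl : d = t - a := by omega
    nlinarith [sq_nonneg (2 * a - t)]
  | succ m ih =>
    intro a b c d hc htr hdet
    have hc0 : c ≠ 0 := by
      rintro rfl
      obtain rfl : d = t - a := by omega
      nlinarith [sq_nonneg (2 * a - t)]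
    obtain ⟨k, hk⟩ := exists_two_mul_add_abs_le a t hc0
    refine (isConj_shear a b c d k).trans ?_
    have htr' : (a + k * c) + (d - k * c) = t := by linarith
    have hdet' : (a + k * c) * (d - k * c) - (b + k * d - k * (a + k * c)) * c = 1 := by
      linear_combination hdet
    generalize a + k * c = a' at *
    generalize d - k * c = d' at *
    generalize b + k * d - k * a' = b' at *
    obtain rfl : d' = t - a' := by omega
    by_cases hbc : b'.natAbs < c.natAbs
    · exact (isConj_swap ..).trans (ih _ _ _ _ (by omega) (by ring) (by linarith))
    · have hbc' : |c| ≤ |b'| := by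
        rw [Int.abs_eq_natAbs, Int.abs_eq_natAbs]
        exact_mod_cast not_lt.1 hbc
      have hneg : b' * c < 0 := by nlinarith [sq_nonneg (2 * a' - t)]
      have habs : |b'| * |c| = -(b' * c) := by rw [← abs_mul, abs_of_neg hneg]
      have hsq : (2 * a' - t) ^ 2 ≤ |c| ^ 2 := sq_le_sq' (by linarith [(abs_le.1 hk).1])
        (abs_le.1 hk).2
      have hc1 : |c| = 1 := by
        have := abs_pos.2 hc0
        nlinarith [mul_le_mul_of_nonneg_right hbc' this.le, sq_nonneg t]
      have main : ∀ a b : ℤ, a * (t - a) - b * (-1) = 1 →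
          IsConj !![a, b; -1, t - a] !![0, 1; -1, t] := by
        intro a b h
        convert isConj_shear a b (-1) (t - a) a using 2
        obtain rfl : b = 1 - a * (t - a) := by linarith
        ext i j
        fin_cases i <;> fin_cases j <;> simp
      rcases eq_or_eq_neg_of_abs_eq hc1 with rfl | rfl
      · exact (isConj_flip ..).trans (main _ _ (by linarith))
      · exact main _ _ hdet'

theorem isConj_companion (hB : B.det = 1) (ht : |B.trace| < 2) :
    IsConj B !![0, 1; -1, B.trace] := by
  rw [det_fin_two] at hB
  conv_lhs => rw [eta_fin_two B]
  exact isConj_companion_of_entries ht _ _ _ _ _ le_rfl (trace_fin_two B).symm hB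

end TwoByTwo

/-! ### Affine matrices -/

/-- The `3 × 3` matrix with linear part `B`, translation part `u` and last row `(0, 0, 1)`. -/
def affine (B : Matrix (Fin 2) (Fin 2) ℤ) (u : Fin 2 → ℤ) : Matrix (Fin 3) (Fin 3) ℤ :=
  !![B 0 0, B 0 1, u 0; B 1 0, B 1 1, u 1; 0, 0, 1]

theorem affine_mul (B C : Matrix (Fin 2) (Fin 2) ℤ) (u v : Fin 2 → ℤ) :
    affine B u * affine C v = affine (B * C) (B *ᵥ v + u) := by
  ext i j
  fin_cases i <;> fin_cases j <;>
    simp [affine, mul_apply, Fin.sum_univ_three, Fin.sum_univ_two]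

theorem affine_one_zero : affine 1 0 = 1 := by
  ext i j
  fin_cases i <;> fin_cases j <;> simp [affine]

theorem affine_injective {B C : Matrix (Fin 2) (Fin 2) ℤ} {u v : Fin 2 → ℤ}
    (h : affine B u = affine C v) : B = C ∧ u = v := by
  have e := fun i j => congrFun (congrFun h i) j
  constructor
  · ext i j
    fin_cases i <;> fin_cases j
    · exact e 0 0
    · exact e 0 1
    · exact e 1 0
    · exact e 1 1
  · ext i
    fin_cases i
    · exact e 0 2
    · exact e 1 2

theorem det_affine (B : Matrix (Fin 2) (Fin 2) ℤ) (u : Fin 2 → ℤ) :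
    (affine B u).det = B.det := by
  simp [affine, det_fin_three, det_fin_two]

theorem exists_affine_pow (B : Matrix (Fin 2) (Fin 2) ℤ) (u : Fin 2 → ℤ) (n : ℕ) :
    ∃ v, affine B u ^ n = affine (B ^ n) v := by
  induction n with
  | zero => exact ⟨0, by simp [affine_one_zero]⟩
  | succ n ih =>
    obtain ⟨v, hv⟩ := ih
    exact ⟨_, by rw [pow_succ, hv, affine_mul, pow_succ]⟩

theorem pow_eq_one_of_affine {B : Matrix (Fin 2) (Fin 2) ℤ} {u : Fin 2 → ℤ} {n : ℕ}
    (h : affine B u ^ n = 1) : B ^ n = 1 := by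
  obtain ⟨v, hv⟩ := exists_affine_pow B u n
  exact (affine_injective (hv.symm.trans (h.trans affine_one_zero.symm))).1

theorem isConj_affine_linear {B C P : Matrix (Fin 2) (Fin 2) ℤ} (hP : IsUnit P.det)
    (h : P * B = C * P) (u : Fin 2 → ℤ) : IsConj (affine B u) (affine C (P *ᵥ u)) := by
  refine isConj_of_isUnit_det (affine P 0) (by rwa [det_affine]) ?_
  rw [affine_mul, affine_mul, h]
  simp

theorem exists_isConj_affine {B C : Matrix (Fin 2) (Fin 2) ℤ} (h : IsConj B C) (u : Fin 2 → ℤ) :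
    ∃ v, IsConj (affine B u) (affine C v) := by
  obtain ⟨P, hP⟩ := h
  exact ⟨_, isConj_affine_linear ((Matrix.isUnit_iff_isUnit_det _).1 P.isUnit) hP u⟩

theorem isConj_affine_translate (B : Matrix (Fin 2) (Fin 2) ℤ) (u v : Fin 2 → ℤ) :
    IsConj (affine B u) (affine B (u + v - B *ᵥ v)) := by
  refine isConj_of_isUnit_det (affine 1 v) (by simp [det_affine]) ?_
  rw [affine_mul, affine_mul, one_mulVec, one_mul, mul_one, add_sub_cancel]

theorem isConj_affine_of_eq {B : Matrix (Fin 2) (Fin 2) ℤ} {u w : Fin 2 → ℤ} (v : Fin 2 → ℤ)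
    (h : w = u + v - B *ᵥ v) : IsConj (affine B u) (affine B w) :=
  h ▸ isConj_affine_translate B u v

theorem isConj_affine_neg (B : Matrix (Fin 2) (Fin 2) ℤ) (u : Fin 2 → ℤ) :
    IsConj (affine B u) (affine B (-u)) := by
  have h := isConj_affine_linear (B := B) (C := B) (P := -1) (by simp [det_neg]) (by simp) u
  rwa [neg_mulVec, one_mulVec] at h

theorem affine_one_eq_one {u : Fin 2 → ℤ} {n : ℕ} (hn : 0 < n) (h : affine 1 u ^ n = 1) :
    affine 1 u = 1 := by
  rw [← sub_eq_zero]
  refine eq_zero_of_one_add_pow_eq_one ?_ hn (by simpa using h)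
  ext i j
  fin_cases i <;> fin_cases j <;> simp [affine, mul_apply, Fin.sum_univ_three]

theorem affine_neg_one_classification (u : Fin 2 → ℤ) :
    IsConj (affine (-1) u) (affine (-1) 0) ∨ IsConj (affine (-1) u) (affine (-1) ![-1, 0]) := by
  -- Reduce the translation part modulo 2, then use `GL₂` to move it to the first axis.
  have step : ∀ x y : ℤ, ∀ p q : ℤ, u = ![2 * p + x, 2 * q + y] →
      IsConj (affine (-1) u) (affine (-1) ![x, y]) := by
    rintro x y p q rfl
    refine isConj_affine_of_eq ![-p, -q] ?_
    ext i
    fin_cases i <;> simp <;> ring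
  have key : ∀ x y : ℤ, ∀ P : Matrix (Fin 2) (Fin 2) ℤ, IsUnit P.det → P *ᵥ ![x, y] = ![-1, 0] →
      IsConj (affine (-1) ![x, y]) (affine (-1) ![-1, 0]) := by
    intro x y P hP h
    have := isConj_affine_linear (B := -1) (C := -1) hP (by simp) ![x, y]
    rwa [h] at this
  have hu : u = ![u 0, u 1] := by ext i; fin_cases i <;> rfl
  obtain ⟨p, hp⟩ := Int.even_or_odd' (u 0)
  obtain ⟨q, hq⟩ := Int.even_or_odd' (u 1)
  rcases hp with hp | hp <;> rcases hq with hq | hq <;> rw [hp, hq] at hu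
  · left
    convert step 0 0 p q (by simpa using hu) using 2
    ext i; fin_cases i <;> rfl
  · right
    refine (step 0 1 p q (by simpa using hu)).trans (key 0 1 !![0, -1; 1, 0] ?_ ?_)
    · simp [det_fin_two]
    · ext i; fin_cases i <;> simp
  · right
    refine (step 1 0 p q (by simpa using hu)).trans (key 1 0 !![-1, 0; 0, 1] ?_ ?_)
    · simp [det_fin_two]
    · ext i; fin_cases i <;> simp
  · right
    refine (step 1 1 p q (by simpa using hu)).trans (key 1 1 !![-1, 0; 1, -1] ?_ ?_)
    · simp [det_fin_two]
    · ext i; fin_cases i <;> simp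

/-- The translation part over a companion matrix only matters modulo `2 - t`. -/
theorem isConj_affine_companion {t : ℤ} {u : Fin 2 → ℤ} {x : ℤ} (k : ℤ)
    (h : u 0 - u 1 = x + k * (2 - t)) :
    IsConj (affine !![0, 1; -1, t] u) (affine !![0, 1; -1, t] ![x, 0]) := by
  refine isConj_affine_of_eq ![-u 1 - (1 - t) * k, k] ?_
  ext i
  fin_cases i
  · simp [vecHead]
    linarith
  · simp [vecHead, vecTail]
    ring

theorem affine_companion_neg_one_classification (u : Fin 2 → ℤ) :
    IsConj (affine !![0, 1; -1, -1] u) (affine !![0, 1; -1, -1] ![0, 0]) ∨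
      IsConj (affine !![0, 1; -1, -1] u) (affine !![0, 1; -1, -1] ![1, 0]) := by
  have h : (u 0 - u 1) % 3 = 0 ∨ (u 0 - u 1) % 3 = 1 ∨ (u 0 - u 1) % 3 = 2 := by omega
  rcases h with h | h | h
  · exact .inl (isConj_affine_companion ((u 0 - u 1) / 3) (by omega))
  · exact .inr (isConj_affine_companion ((u 0 - u 1) / 3) (by omega))
  · refine .inr ((isConj_affine_companion (x := -1) ((u 0 - u 1) / 3 + 1) (by omega)).trans ?_)
    simpa using isConj_affine_neg !![0, 1; -1, -1] ![-1, 0]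

theorem affine_companion_zero_classification (u : Fin 2 → ℤ) :
    IsConj (affine !![0, 1; -1, 0] u) (affine !![0, 1; -1, 0] ![0, 0]) ∨
      IsConj (affine !![0, 1; -1, 0] u) (affine !![0, 1; -1, 0] ![1, 0]) := by
  rcases Int.emod_two_eq_zero_or_one (u 0 - u 1) with h | h
  · exact .inl (isConj_affine_companion ((u 0 - u 1) / 2) (by omega))
  · exact .inr (isConj_affine_companion ((u 0 - u 1) / 2) (by omega))

theorem affine_companion_one_classification (u : Fin 2 → ℤ) :
    IsConj (affine !![0, 1; -1, 1] u) (affine !![0, -1; 1, 1] ![0, 0]) := by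
  refine (isConj_affine_companion (x := 0) (u 0 - u 1) (by ring)).trans ?_
  convert isConj_affine_linear (B := !![0, 1; -1, 1]) (C := !![0, -1; 1, 1])
    (P := !![1, 0; 0, -1]) (by simp [det_fin_two]) (by decide) ![0, 0] using 2
  decide

/-! ### Reduction to affine matrices -/

/-- A torsion matrix preserves the positive definite form `∑ₖ (Aᵏ)ᵀ Aᵏ`. -/
theorem exists_invariant_form {m : Type*} [Fintype m] [DecidableEq m] {A : Matrix m m ℤ} {n : ℕ}
    (hn : 0 < n) (h : A ^ n = 1) : ∃ Q : Matrix m m ℤ, Q.det ≠ 0 ∧ Aᵀ * Q * A = Q := by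
  refine ⟨∑ k ∈ Finset.range n, (A ^ k)ᵀ * A ^ k, ?_, ?_⟩
  · intro hdet
    obtain ⟨v, hv, hQ⟩ := exists_mulVec_eq_zero_iff.2 hdet
    have hsum : ∑ k ∈ Finset.range n, (A ^ k *ᵥ v) ⬝ᵥ (A ^ k *ᵥ v) = 0 := by
      rw [← dotProduct_zero v, ← hQ, sum_mulVec, dotProduct_sum]
      refine Finset.sum_congr rfl fun k _ => ?_
      rw [← mulVec_mulVec, dotProduct_mulVec, dotProduct_mulVec, vecMul_transpose,
        ← dotProduct_mulVec]
    have hnonneg : ∀ k ∈ Finset.range n, 0 ≤ (A ^ k *ᵥ v) ⬝ᵥ (A ^ k *ᵥ v) := fun k _ =>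
      Finset.sum_nonneg fun i _ => mul_self_nonneg _
    have hzero := (Finset.sum_eq_zero_iff_of_nonneg hnonneg).1 hsum 0 (Finset.mem_range.2 hn)
    exact hv (by simpa using hzero)
  · have hstep : ∀ k, Aᵀ * ((A ^ k)ᵀ * A ^ k) * A = (A ^ (k + 1))ᵀ * A ^ (k + 1) := fun k => by
      rw [pow_succ, transpose_mul]
      simp only [Matrix.mul_assoc]
    rw [Finset.mul_sum, Finset.sum_mul, Finset.sum_congr rfl fun k _ => hstep k]
    have := (Finset.sum_range_succ (fun k => (A ^ k)ᵀ * A ^ k) n).symm.trans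
      (Finset.sum_range_succ' (fun k => (A ^ k)ᵀ * A ^ k) n)
    simpa [h] using this.symm

theorem det_sub_one_eq_zero {A : Matrix (Fin 3) (Fin 3) ℤ} {n : ℕ} (hn : 0 < n) (h : A ^ n = 1)
    (hA : A.det = 1) : (A - 1).det = 0 := by
  obtain ⟨Q, hQ, hinv⟩ := exists_invariant_form hn h
  have key : Aᵀ * Q * (A - 1) = -((A - 1)ᵀ * Q) := by
    rw [mul_sub, hinv, transpose_sub, transpose_one, sub_mul, one_mul, mul_one, neg_sub]
  have hdet := congrArg det key
  rw [det_neg, det_mul, det_mul, det_mul, det_transpose, det_transpose, hA] at hdet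
  have : Q.det * (A - 1).det = 0 := by
    simp at hdet
    linarith
  exact (mul_eq_zero.1 this).resolve_left hQ

theorem exists_unimodular_mul_eq_zero (a b : ℤ) :
    ∃ p q r s : ℤ, p * s - q * r = 1 ∧ a * p + b * r = 0 := by
  rcases eq_or_ne (Int.gcd a b) 0 with h | h
  · obtain ⟨rfl, rfl⟩ := Int.gcd_eq_zero_iff.1 h
    exact ⟨1, 0, 0, 1, by simp, by simp⟩
  · obtain ⟨g, a', b', hg, hcop, ha, hb⟩ := Int.exists_gcd_one' (Nat.pos_of_ne_zero h)
    obtain ⟨x, y, hxy⟩ := Int.isCoprime_iff_gcd_eq_one.2 hcop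
    exact ⟨b', x, -a', y, by linarith, by rw [ha, hb]; ring⟩

theorem exists_vecMul_eq_last (w : Fin 3 → ℤ) :
    ∃ (P : Matrix (Fin 3) (Fin 3) ℤ) (d : ℤ), IsUnit P.det ∧ w ᵥ* P = ![0, 0, d] := by
  obtain ⟨p, q, r, s, hdet, h⟩ := exists_unimodular_mul_eq_zero (w 0) (w 1)
  obtain ⟨p', q', r', s', hdet', h'⟩ := exists_unimodular_mul_eq_zero (w 0 * q + w 1 * s) (w 2)
  refine ⟨!![p, q, 0; r, s, 0; 0, 0, 1] * !![1, 0, 0; 0, p', q'; 0, r', s'],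
    (w 0 * q + w 1 * s) * q' + w 2 * s', ?_, ?_⟩
  · rw [det_mul]
    simp [det_fin_three, hdet, hdet']
  · rw [← vecMul_vecMul]
    ext i
    fin_cases i <;> simp [vecMul, dotProduct, Fin.sum_univ_three, h, h']

theorem exists_isConj_affine_of_torsion {A : Matrix (Fin 3) (Fin 3) ℤ} {n : ℕ} (hn : 0 < n)
    (h : A ^ n = 1) (hA : A.det = 1) : ∃ B u, IsConj A (affine B u) := by
  obtain ⟨w, hw, hwA⟩ := exists_vecMul_eq_zero_iff.2 (det_sub_one_eq_zero hn h hA)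
  rw [vecMul_sub, vecMul_one, sub_eq_zero] at hwA
  obtain ⟨P, d, hP, hwP⟩ := exists_vecMul_eq_last w
  have hd : d ≠ 0 := by
    rintro rfl
    apply hw
    have h0 : w ᵥ* P ᵥ* P⁻¹ = 0 := by
      rw [hwP]
      ext i
      fin_cases i <;> simp [vecMul, dotProduct, Fin.sum_univ_three]
    rwa [vecMul_vecMul, mul_nonsing_inv _ hP, vecMul_one] at h0
  have hrow : ![0, 0, d] ᵥ* (P⁻¹ * A * P) = ![0, 0, d] := by
    rw [← hwP, vecMul_vecMul, Matrix.mul_assoc, mul_nonsing_inv_cancel_left _ _ hP,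
      ← vecMul_vecMul, hwA]
  have hconj : IsConj A (P⁻¹ * A * P) := by
    refine isConj_of_isUnit_det P⁻¹ (isUnit_nonsing_inv_det _ hP) ?_
    rw [Matrix.mul_assoc _ P, mul_nonsing_inv _ hP, Matrix.mul_one]
  generalize P⁻¹ * A * P = C at hrow hconj
  have e := fun j => congrFun hrow j
  simp only [vecMul, dotProduct, Fin.sum_univ_three] at e
  have e0 : C 2 0 = 0 := by simpa [hd] using e 0
  have e1 : C 2 1 = 0 := by simpa [hd] using e 1
  have e2 : C 2 2 = 1 := by simpa [hd] using e 2
  refine ⟨!![C 0 0, C 0 1; C 1 0, C 1 1], ![C 0 2, C 1 2], ?_⟩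
  convert hconj using 1
  ext i j
  fin_cases i <;> fin_cases j <;> simp [affine, e0, e1, e2]

/-! ### The list of representatives -/

/-- The sixteen representatives of the conjugacy classes of torsion elements of `GL₃(ℤ)`. -/
def representative : Fin 16 → Matrix (Fin 3) (Fin 3) ℤ :=
  ![!![1, 0, 0; 0, 1, 0; 0, 0, 1],
    !![-1, 0, 0; 0, -1, 0; 0, 0, -1],
    !![1, 0, 0; 0, 1, 0; 0, 0, -1],
    !![1, 0, 1; 0, 1, 0; 0, 0, -1],
    !![-1, 0, 0; 0, -1, 0; 0, 0, 1],
    !![-1, 0, -1; 0, -1, 0; 0, 0, 1],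
    !![0, 1, 0; -1, -1, 0; 0, 0, 1],
    !![0, 1, 1; -1, -1, 0; 0, 0, 1],
    !![0, -1, 0; 1, 1, 0; 0, 0, -1],
    !![0, -1, -1; 1, 1, 0; 0, 0, -1],
    !![0, 1, 0; -1, -1, 0; 0, 0, -1],
    !![0, -1, 0; 1, 1, 0; 0, 0, 1],
    !![0, 1, 0; -1, 0, 0; 0, 0, 1],
    !![0, 1, 1; -1, 0, 0; 0, 0, 1],
    !![0, -1, 0; 1, 0, 0; 0, 0, -1],
    !![0, -1, -1; 1, 0, 0; 0, 0, -1]]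

theorem exists_representative_of_det_eq_one {A : Matrix (Fin 3) (Fin 3) ℤ} {n : ℕ} (hn : 0 < n)
    (h : A ^ n = 1) (hA : A.det = 1) : ∃ i, IsConj A (representative i) := by
  obtain ⟨B, u, hAB⟩ := exists_isConj_affine_of_torsion hn h hA
  have hpow : affine B u ^ n = 1 := pow_eq_one_of_isConj hAB h
  have hBn : B ^ n = 1 := pow_eq_one_of_affine hpow
  have hB : B.det = 1 := by
    obtain ⟨P, hP⟩ := hAB
    have hdet := congrArg det hP.eq
    rw [det_mul, det_mul, hA, mul_comm, det_affine] at hdet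
    exact (mul_right_cancel₀ ((Matrix.isUnit_iff_isUnit_det _).1 P.isUnit).ne_zero hdet).symm
  have htr := abs_le.1 (abs_trace_le_two hB hn hBn)
  obtain ht | ht | ht : B.trace = 2 ∨ B.trace = -2 ∨ |B.trace| < 2 := by
    rw [abs_lt]
    omega
  · obtain rfl := eq_one_of_trace_eq_two hB hn hBn ht
    rw [affine_one_eq_one hn hpow] at hAB
    refine ⟨0, ?_⟩
    convert hAB using 1
    decide
  · obtain rfl := eq_neg_one_of_trace_eq_neg_two hB hn hBn ht
    rcases affine_neg_one_classification u with hu | hu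
    · refine ⟨4, ?_⟩
      convert hAB.trans hu using 1
      decide
    · refine ⟨5, ?_⟩
      convert hAB.trans hu using 1
      decide
  · obtain ⟨v, hv⟩ := exists_isConj_affine (isConj_companion hB ht) u
    have hAv := hAB.trans hv
    obtain ht | ht | ht : B.trace = -1 ∨ B.trace = 0 ∨ B.trace = 1 := by
      rw [abs_lt] at ht
      omega
    all_goals rw [ht] at hAv
    · rcases affine_companion_neg_one_classification v with hu | hu
      · exact ⟨6, hAv.trans hu⟩
      · exact ⟨7, hAv.trans hu⟩
    · rcases affine_companion_zero_classification v with hu | hu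
      · exact ⟨12, hAv.trans hu⟩
      · exact ⟨13, hAv.trans hu⟩
    · exact ⟨11, hAv.trans (affine_companion_one_classification v)⟩

theorem exists_neg_representative : ∀ i, ∃ j, representative j = -representative i := by
  decide

theorem exists_representative {A : Matrix (Fin 3) (Fin 3) ℤ} {n : ℕ} (hn : 0 < n)
    (h : A ^ n = 1) : ∃ i, IsConj A (representative i) := by
  have hunit : IsUnit A.det := IsUnit.of_pow_eq_one (by rw [← det_pow, h, det_one]) hn.ne'
  rcases Int.isUnit_iff.1 hunit with hA | hA
  · exact exists_representative_of_det_eq_one hn h hA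
  · obtain ⟨i, hi⟩ := exists_representative_of_det_eq_one (A := -A) (n := 2 * n) (by omega)
      (by rw [pow_mul, neg_sq, ← pow_mul, mul_comm, pow_mul, h, one_pow])
      (by simp [det_neg, hA, Odd.neg_one_pow (show Odd 3 by decide)])
    obtain ⟨j, hj⟩ := exists_neg_representative i
    exact ⟨j, by simpa [hj] using isConj_neg hi⟩

/-! ### Separating the representatives -/

/-- Reduction of an integer matrix modulo `m`. -/
def reduceMod (m : ℕ) (A : Matrix (Fin 3) (Fin 3) ℤ) : Matrix (Fin 3) (Fin 3) (ZMod m) :=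
  (Int.castRingHom (ZMod m)).mapMatrix A

theorem isConj_reduceMod (m : ℕ) {A B : Matrix (Fin 3) (Fin 3) ℤ} (h : IsConj A B) :
    IsConj (reduceMod m A) (reduceMod m B) :=
  ((Int.castRingHom (ZMod m)).mapMatrix (m := Fin 3)).toMonoidHom.map_isConj h

theorem isConj_add_intCast {R : Type*} [Ring R] {a b : R} (h : IsConj a b) (s : ℤ) :
    IsConj (a + s) (b + s) := by
  obtain ⟨c, hc⟩ := h
  exact ⟨c, hc.add_right (Int.cast_commute s (c : R)).symm⟩

theorem isConj_eq_zero_iff {R : Type*} [Ring R] {a b : R} (h : IsConj a b) : a = 0 ↔ b = 0 := by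
  obtain ⟨c, hc⟩ := h
  rw [← c.mul_right_eq_zero, hc.eq, c.mul_left_eq_zero]

theorem trace_eq_of_isConj {n : Type*} [Fintype n] [DecidableEq n] {R : Type*} [CommRing R]
    {A B : Matrix n n R} (h : IsConj A B) : A.trace = B.trace := by
  obtain ⟨P, hP⟩ := h
  rw [← (Units.mul_inv_eq_iff_eq_mul P).2 hP.eq, trace_units_conj]

/-- A complete conjugacy invariant for torsion matrices: the traces of small powers, and the
vanishing of `A - 1`, `(A - 1)²` and `(A + 1)²` modulo small primes. -/
def conjInvariant (A : Matrix (Fin 3) (Fin 3) ℤ) : ℤ × ℤ × ℤ × Bool × Bool × Bool × Bool :=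
  ((A ^ 1).trace, (A ^ 2).trace, (A ^ 3).trace,
    decide ((reduceMod 2 A + (-1 : ℤ)) ^ 1 = 0), decide ((reduceMod 2 A + (-1 : ℤ)) ^ 2 = 0),
    decide ((reduceMod 3 A + (-1 : ℤ)) ^ 2 = 0), decide ((reduceMod 3 A + (1 : ℤ)) ^ 2 = 0))

theorem conjInvariant_eq_of_isConj {A B : Matrix (Fin 3) (Fin 3) ℤ} (h : IsConj A B) :
    conjInvariant A = conjInvariant B := by
  have ht : ∀ k, (A ^ k).trace = (B ^ k).trace := fun k => trace_eq_of_isConj (h.pow k)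
  have hz : ∀ (m : ℕ) (s : ℤ) (k : ℕ),
      (reduceMod m A + s) ^ k = 0 ↔ (reduceMod m B + s) ^ k = 0 := fun m s k =>
    isConj_eq_zero_iff ((isConj_add_intCast (isConj_reduceMod m h) s).pow k)
  simp only [conjInvariant, ht, hz]

theorem conjInvariant_representative_injective :
    Function.Injective fun i => conjInvariant (representative i) := by
  have h : ∀ i j, conjInvariant (representative i) = conjInvariant (representative j) → i = j := by
    set_option synthInstance.maxSize 1000 in
    decide +kernel
  exact fun i j => h i j

theorem isConj_iff_exists_units {M : Type*} [Monoid M] {a b : M} :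
    IsConj a b ↔ ∃ c : Mˣ, (c : M) * a * ((c⁻¹ : Mˣ) : M) = b :=
  exists_congr fun c => (Units.mul_inv_eq_iff_eq_mul c).symm

theorem eq_of_isConj_representative {i j : Fin 16}
    (h : IsConj (representative i) (representative j)) : i = j :=
  conjInvariant_representative_injective (conjInvariant_eq_of_isConj h)

end GL3ZTorsion

/-- **Torsion elements of `GL₃(ℤ)` up to conjugacy.**
Every element of finite order of `GL₃(ℤ)` is conjugate in `GL₃(ℤ)` to exactly one of the
sixteen listed matrices; in particular no two distinct matrices of the list are conjugate
in `GL₃(ℤ)`. -/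
theorem torsion_classification_GL3Z
    (L : Fin 16 → Matrix (Fin 3) (Fin 3) ℤ)
    (hL : L = ![
      !![1, 0, 0; 0, 1, 0; 0, 0, 1],
      !![-1, 0, 0; 0, -1, 0; 0, 0, -1],
      !![1, 0, 0; 0, 1, 0; 0, 0, -1],
      !![1, 0, 1; 0, 1, 0; 0, 0, -1],
      !![-1, 0, 0; 0, -1, 0; 0, 0, 1],
      !![-1, 0, -1; 0, -1, 0; 0, 0, 1],
      !![0, 1, 0; -1, -1, 0; 0, 0, 1],
      !![0, 1, 1; -1, -1, 0; 0, 0, 1],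
      !![0, -1, 0; 1, 1, 0; 0, 0, -1],
      !![0, -1, -1; 1, 1, 0; 0, 0, -1],
      !![0, 1, 0; -1, -1, 0; 0, 0, -1],
      !![0, -1, 0; 1, 1, 0; 0, 0, 1],
      !![0, 1, 0; -1, 0, 0; 0, 0, 1],
      !![0, 1, 1; -1, 0, 0; 0, 0, 1],
      !![0, -1, 0; 1, 0, 0; 0, 0, -1],
      !![0, -1, -1; 1, 0, 0; 0, 0, -1]]) :
    (∀ A : GL (Fin 3) ℤ, IsOfFinOrder A →
      ∃! i : Fin 16, ∃ P : GL (Fin 3) ℤ,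
        (P : Matrix (Fin 3) (Fin 3) ℤ) * (A : Matrix (Fin 3) (Fin 3) ℤ) *
            ((P⁻¹ : GL (Fin 3) ℤ) : Matrix (Fin 3) (Fin 3) ℤ) = L i) ∧
    (∀ i j : Fin 16,
      (∃ P : GL (Fin 3) ℤ,
        (P : Matrix (Fin 3) (Fin 3) ℤ) * L i *
            ((P⁻¹ : GL (Fin 3) ℤ) : Matrix (Fin 3) (Fin 3) ℤ) = L j) → i = j) := by
  have hrep : L = GL3ZTorsion.representative := hL
  subst hrep
  simp only [← GL3ZTorsion.isConj_iff_exists_units]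
  refine ⟨fun A hA => ?_, fun i j h => GL3ZTorsion.eq_of_isConj_representative h⟩
  obtain ⟨n, hn, hAn⟩ := isOfFinOrder_iff_pow_eq_one.1 hA
  obtain ⟨i, hi⟩ := GL3ZTorsion.exists_representative (A := (A : Matrix (Fin 3) (Fin 3) ℤ)) hn
    (by rw [← Units.val_pow_eq_pow_val, hAn, Units.val_one])
  exact ⟨i, hi, fun j hj => GL3ZTorsion.eq_of_isConj_representative (hj.symm.trans hi)⟩
end
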